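/- (Classification of multiplicity-free products) For partitions λ and μ, the product G_λ·G_μ is multiplicity free—meaning that c^ν_{λμ} ∈ {−1,0,1} for every partition ν—if and only if both λ and μ are rectangular partitions (of the form (a^b)), or at least one of λ and μ is the empty partition or the single-box partition (1). -/

import Mathlib

open MvPolynomial

/-- A set-valued tableau on an arbitrary finite set of boxes `(row, column)`.
Entries are `0`-based: the entry `i : ℕ` stands for the integer `i + 1`
(equivalently, for the variable `x_{i+1}`).  Rows weakly increase from left to
right and columns strictly increase from top to bottom, expressed via
horizontally and vertically adjacent boxes. -/
structure SVT (cells : Finset (ℕ × ℕ)) where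
  entry : ℕ × ℕ → Finset ℕ
  nonempty_of_mem : ∀ c ∈ cells, (entry c).Nonempty
  eq_empty_of_not_mem : ∀ c, c ∉ cells → entry c = ∅
  row_weak : ∀ i j, (i, j) ∈ cells → (i, j + 1) ∈ cells →
    ∀ a ∈ entry (i, j), ∀ b ∈ entry (i, j + 1), a ≤ b
  col_strict : ∀ i j, (i, j) ∈ cells → (i + 1, j) ∈ cells →
    ∀ a ∈ entry (i, j), ∀ b ∈ entry (i + 1, j), a < b

namespace SVT

variable {cells : Finset (ℕ × ℕ)}

/-- `|T|`: the total number of integers in the boxes of `T`. -/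
def size (T : SVT cells) : ℕ := ∑ c ∈ cells, (T.entry c).card

/-- `T` has all its entries among `{1, …, m}` (i.e. `0`-based entries `< m`). -/
def Bounded (T : SVT cells) (m : ℕ) : Prop := ∀ c, ∀ x ∈ T.entry c, x < m

/-- The monomial `x^T`, where the exponent of the variable `i` is the number of
boxes of `T` containing `i`. -/
noncomputable def monomial (T : SVT cells) : MvPolynomial ℕ ℤ :=
  ∏ c ∈ cells, ∏ i ∈ T.entry c, X i

/-- The column word of `T`: columns are read from left to right, each column
from bottom to top, the integers within a box in increasing order. -/
def word (T : SVT cells) : List ℕ :=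
  (List.range ((cells.sup fun c => max c.1 c.2) + 1)).flatMap fun j =>
    ((List.range ((cells.sup fun c => max c.1 c.2) + 1)).reverse).flatMap fun i =>
      (T.entry (i, j)).sort (· ≤ ·)

end SVT

/-- The stable Grothendieck polynomial of the shape given by `cells`, in the
variables `x_1, …, x_m` (`0`-based: variables `0, …, m-1`):
`G(cells) = ∑_T (-1)^(|T| - #cells) x^T` over set-valued tableaux `T` of shape
`cells` with entries in `{1, …, m}`. -/
noncomputable def grothendieck (cells : Finset (ℕ × ℕ)) (m : ℕ) : MvPolynomial ℕ ℤ :=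
  ∑ᶠ (T : SVT cells) (_ : T.Bounded m), ((-1 : ℤ) ^ (T.size - cells.card)) • T.monomial

/-- A reverse lattice word: every suffix contains, for each `i`, at least as
many occurrences of `i` as of `i + 1`. -/
def IsRLW (w : List ℕ) : Prop := ∀ s, s <:+ w → ∀ i, s.count (i + 1) ≤ s.count i

/-- A partial reverse lattice word with respect to the (`0`-based, half-open)
interval `[a, b)`:  every suffix contains, for each `t` with `a ≤ t` and
`t + 1 < b`, at least as many occurrences of `t` as of `t + 1`. -/
def IsPartialRLW (a b : ℕ) (w : List ℕ) : Prop :=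
  ∀ s, s <:+ w → ∀ t, a ≤ t → t + 1 < b → s.count (t + 1) ≤ s.count t

/-- `w` has content `ν`: the number of occurrences of `i` in `w` is the length
of the `i`-th row of `ν`. -/
def HasContent (w : List ℕ) (nu : YoungDiagram) : Prop := ∀ i, w.count i = nu.rowLen i

/-- The cells of the skew diagram `λ * μ`, obtained by placing `λ` and `μ`
corner to corner: `λ` occupies rows `0, …, ℓ(λ)-1` shifted right by `μ₁`
columns, and `μ` occupies the rows below row `ℓ(λ)-1`. -/
def starCells (lam mu : YoungDiagram) : Finset (ℕ × ℕ) :=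
  (lam.cells.image fun c => (c.1, c.2 + mu.rowLen 0)) ∪
    (mu.cells.image fun c => (c.1 + lam.colLen 0, c.2))

/-- The structure constant `c^ν_{λμ}`: `(-1)^(|ν|-|λ|-|μ|)` times the number of
set-valued tableaux of shape `λ * μ` whose word is a reverse lattice word with
content `ν`. -/
noncomputable def cLR (lam mu nu : YoungDiagram) : ℤ :=
  (-1 : ℤ) ^ (nu.card - lam.card - mu.card) *
    (Nat.card {T : SVT (starCells lam mu) // IsRLW T.word ∧ HasContent T.word nu} : ℤ)

/-- The coproduct structure constant `d^ν_{λμ}`: `(-1)^(|λ|+|μ|-|ν|)` times the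
number of set-valued tableaux of shape `ν` whose word is a partial reverse
lattice word with respect to both intervals `[1, ℓ(λ)]` and
`[ℓ(λ)+1, ℓ(λ)+ℓ(μ)]` and has content `(λ₁, …, λ_{ℓ(λ)}, μ₁, …, μ_{ℓ(μ)})`. -/
noncomputable def dCoeff (lam mu nu : YoungDiagram) : ℤ :=
  (-1 : ℤ) ^ (lam.card + mu.card - nu.card) *
    (Nat.card {T : SVT nu.cells //
      IsPartialRLW 0 (lam.colLen 0) T.word ∧
      IsPartialRLW (lam.colLen 0) (lam.colLen 0 + mu.colLen 0) T.word ∧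
      ∀ i, T.word.count i =
        if i < lam.colLen 0 then lam.rowLen i else mu.rowLen (i - lam.colLen 0)} : ℤ)

/-- The coefficient `α_{θ,μ}` for a shape `θ` given by `cells`:
`(-1)^(|μ|-|θ|)` times the number of set-valued tableaux of shape `θ` whose
word is a reverse lattice word with content `μ`. -/
noncomputable def alphaCoeff (cells : Finset (ℕ × ℕ)) (mu : YoungDiagram) : ℤ :=
  (-1 : ℤ) ^ (mu.card - cells.card) *
    (Nat.card {T : SVT cells // IsRLW T.word ∧ HasContent T.word mu} : ℤ)

/-- `ν/λ` is a vertical strip: at most one box in each row. -/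
def IsVerticalStrip (lam nu : YoungDiagram) : Prop := ∀ i, nu.rowLen i ≤ lam.rowLen i + 1

/-- `ν/λ` is a horizontal strip: at most one box in each column. -/
def IsHorizontalStrip (lam nu : YoungDiagram) : Prop := ∀ j, nu.colLen j ≤ lam.colLen j + 1

/-- A set of boxes is a rook strip if it has at most one box in each row and in
each column. -/
def IsRookStripCells (s : Finset (ℕ × ℕ)) : Prop :=
  (∀ i, (s.filter fun c => c.1 = i).card ≤ 1) ∧ (∀ j, (s.filter fun c => c.2 = j).card ≤ 1)

/-- The rectangular Young diagram with `p` rows and `q` columns. -/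
def rect (p q : ℕ) : YoungDiagram :=
  ⟨Finset.range p ×ˢ Finset.range q, by
    intro a b hba ha
    simp only [Finset.coe_product, Set.mem_prod, Finset.mem_coe, Finset.mem_range] at ha ⊢
    exact ⟨lt_of_le_of_lt hba.1 ha.1, lt_of_le_of_lt hba.2 ha.2⟩⟩
/-- A rectangular partition: one of the form `(a^b)` (possibly empty). -/
def IsRectangular (lam : YoungDiagram) : Prop :=
  ∃ a b, lam.cells = Finset.range b ×ˢ Finset.range a

/-! ### Reverse lattice words of set-valued fillings -/

/-- `Precedes c' c`: the box `c'` occurs strictly to the right of `c` in the column reading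
order, i.e. it is met before `c` when the word is scanned from its end. -/
def Precedes (c' c : ℕ × ℕ) : Prop := c.2 < c'.2 ∨ (c'.2 = c.2 ∧ c'.1 < c.1)

instance (c' c : ℕ × ℕ) : Decidable (Precedes c' c) := by unfold Precedes; infer_instance

/-- The number of boxes of `s` preceding `c` that contain `x`. -/
def countBefore (s : Finset (ℕ × ℕ)) (U : ℕ × ℕ → Finset ℕ) (c : ℕ × ℕ) (x : ℕ) : ℕ :=
  (s.filter fun c' => Precedes c' c ∧ x ∈ U c').card

/-- The number of boxes of `s` that contain `x`. -/
def countAll (s : Finset (ℕ × ℕ)) (U : ℕ × ℕ → Finset ℕ) (x : ℕ) : ℕ :=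
  (s.filter fun c => x ∈ U c).card

theorem isRLW_nil : IsRLW [] := by
  intro s hs i
  rw [List.suffix_nil.mp hs]; simp

theorem isRLW_cons (a : ℕ) (w : List ℕ) :
    IsRLW (a :: w) ↔ IsRLW w ∧ ∀ k, a = k + 1 → w.count (k + 1) + 1 ≤ w.count k := by
  constructor
  · intro h
    refine ⟨fun s hs => h s (hs.trans (List.suffix_cons a w)), ?_⟩
    rintro k rfl
    have := h _ List.suffix_rfl k
    simpa [List.count_cons] using this
  · rintro ⟨h1, h2⟩ s hs i
    rcases List.suffix_cons_iff.mp hs with rfl | hs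
    · have h3 := h1 w List.suffix_rfl i
      by_cases ha : a = i + 1
      · subst ha
        simpa [List.count_cons] using h2 i rfl
      · simp only [List.count_cons, beq_iff_eq, ha, if_false]
        omega
    · exact h1 s hs i

theorem isRLW_append_of_sortedLT (s w : List ℕ) (hs : s.Pairwise (· < ·)) :
    IsRLW (s ++ w) ↔ IsRLW w ∧ ∀ k, k + 1 ∈ s → w.count (k + 1) + 1 ≤ w.count k := by
  induction s with
  | nil => simp
  | cons a s ih =>
    rw [List.pairwise_cons] at hs
    rw [List.cons_append, isRLW_cons, ih hs.2, and_assoc]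
    refine and_congr_right fun _ => ?_
    have hc : ∀ x, x ≤ a → (s ++ w).count x = w.count x := by
      intro x hx
      rw [List.count_append, List.count_eq_zero_of_not_mem, zero_add]
      intro hxs
      exact absurd (hs.1 x hxs) (by omega)
    constructor
    · rintro ⟨h1, h2⟩ k hk
      rcases List.mem_cons.mp hk with hk | hk
      · have := h2 k hk.symm
        rwa [hc _ (by omega), hc _ (by omega)] at this
      · exact h1 k hk
    · intro h
      refine ⟨fun k hk => h k (List.mem_cons_of_mem _ hk), ?_⟩
      rintro k rfl
      rw [hc _ (by omega), hc _ (by omega)]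
      exact h k List.mem_cons_self

theorem count_flatMap_sort (L : List (ℕ × ℕ)) (hL : L.Nodup) (U : ℕ × ℕ → Finset ℕ) (x : ℕ) :
    (L.flatMap fun c => (U c).sort (· ≤ ·)).count x = countAll L.toFinset U x := by
  induction L with
  | nil => simp [countAll]
  | cons a L ih =>
    rw [List.nodup_cons] at hL
    rw [List.flatMap_cons, List.count_append, ih hL.2, countAll, countAll, List.toFinset_cons,
      Finset.filter_insert]
    have hn : ((U a).sort (· ≤ ·)).Nodup := Finset.sort_nodup _ _
    split_ifs with h
    · rw [Finset.card_insert_of_notMem (by simp [hL.1]),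
        List.count_eq_one_of_mem hn (by simpa using h), add_comm]
    · rw [List.count_eq_zero_of_not_mem (by simpa using h), zero_add]

theorem Precedes.asymm {c c' : ℕ × ℕ} (h : Precedes c c') : ¬ Precedes c' c := by
  unfold Precedes at *; omega

theorem isRLW_flatMap_sort (L : List (ℕ × ℕ)) (hL : L.Pairwise fun a b => Precedes b a)
    (U : ℕ × ℕ → Finset ℕ) :
    IsRLW (L.flatMap fun c => (U c).sort (· ≤ ·)) ↔
      ∀ c ∈ L, ∀ k, k + 1 ∈ U c →
        countBefore L.toFinset U c (k + 1) + 1 ≤ countBefore L.toFinset U c k := by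
  induction L with
  | nil => simp [isRLW_nil]
  | cons a L ih =>
    have hnd : (a :: L).Nodup := hL.imp (fun h => by
      rintro rfl; exact h.asymm h)
    rw [List.pairwise_cons] at hL
    rw [List.nodup_cons] at hnd
    rw [List.flatMap_cons, isRLW_append_of_sortedLT _ _ (Finset.sortedLT_sort _).pairwise, ih hL.2,
      List.forall_mem_cons, and_comm]
    have h1 : ∀ x, countBefore (a :: L).toFinset U a x = countAll L.toFinset U x := by
      intro x
      unfold countBefore countAll
      congr 1
      ext c
      simp only [List.toFinset_cons, Finset.mem_filter, Finset.mem_insert, List.mem_toFinset]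
      constructor
      · rintro ⟨rfl | h, h2, h3⟩
        · exact absurd h2 h2.asymm
        · exact ⟨h, h3⟩
      · rintro ⟨h, h2⟩
        exact ⟨Or.inr h, hL.1 c h, h2⟩
    have h2 : ∀ c ∈ L, ∀ x, countBefore (a :: L).toFinset U c x = countBefore L.toFinset U c x := by
      intro c hc x
      unfold countBefore
      rw [List.toFinset_cons, Finset.filter_insert, if_neg]
      exact fun h => (hL.1 c hc).asymm h.1
    refine and_congr ?_ ?_
    · simp only [h1, count_flatMap_sort L hnd.2, Finset.mem_sort]
    · exact forall₂_congr fun c hc => by simp only [h2 c hc]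

/-- The boxes of a square containing `cells`, in column reading order. -/
def readingOrder (n : ℕ) : List (ℕ × ℕ) :=
  (List.range n).flatMap fun j => (List.range n).reverse.map fun i => (i, j)

theorem mem_readingOrder {n : ℕ} {c : ℕ × ℕ} : c ∈ readingOrder n ↔ c.1 < n ∧ c.2 < n := by
  simp [readingOrder, Prod.ext_iff]
  grind

theorem pairwise_readingOrder (n : ℕ) : (readingOrder n).Pairwise fun a b => Precedes b a := by
  rw [readingOrder, List.pairwise_flatMap]
  constructor
  · intro j _
    rw [List.pairwise_map, List.pairwise_reverse]
    exact List.pairwise_lt_range.imp fun h => Or.inr ⟨rfl, h⟩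
  · refine List.pairwise_lt_range.imp fun {a b} h => ?_
    simp only [List.mem_map]
    rintro _ ⟨i, _, rfl⟩ _ ⟨i', _, rfl⟩
    exact Or.inl h

namespace SVT

variable {cells : Finset (ℕ × ℕ)}

theorem ext_entry {T T' : SVT cells} (h : T.entry = T'.entry) : T = T' := by
  cases T; cases T'; congr

theorem mem_cells_of_mem_entry (T : SVT cells) {c : ℕ × ℕ} {x : ℕ} (h : x ∈ T.entry c) :
    c ∈ cells := by
  by_contra hc
  rw [T.eq_empty_of_not_mem c hc] at h
  simp at h

theorem word_eq (T : SVT cells) :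
    T.word = (readingOrder ((cells.sup fun c => max c.1 c.2) + 1)).flatMap
      fun c => (T.entry c).sort (· ≤ ·) := by
  simp only [word, readingOrder, List.flatMap_assoc, List.flatMap_map]

theorem mem_readingOrder_of_mem {c : ℕ × ℕ} (hc : c ∈ cells) :
    c ∈ readingOrder ((cells.sup fun c => max c.1 c.2) + 1) := by
  have h : max c.1 c.2 ≤ cells.sup fun c => max c.1 c.2 :=
    Finset.le_sup (f := fun c : ℕ × ℕ => max c.1 c.2) hc
  rw [mem_readingOrder]
  omega

theorem count_word (T : SVT cells) (x : ℕ) : T.word.count x = countAll cells T.entry x := by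
  rw [word_eq, count_flatMap_sort]
  · unfold countAll
    congr 1
    ext c
    simp only [Finset.mem_filter, List.mem_toFinset]
    exact ⟨fun h => ⟨T.mem_cells_of_mem_entry h.2, h.2⟩,
      fun h => ⟨mem_readingOrder_of_mem h.1, h.2⟩⟩
  · exact (pairwise_readingOrder _).imp fun h => by rintro rfl; exact h.asymm h

theorem isRLW_word_iff (T : SVT cells) :
    IsRLW T.word ↔ ∀ c k, k + 1 ∈ T.entry c →
      countBefore cells T.entry c (k + 1) + 1 ≤ countBefore cells T.entry c k := by
  rw [word_eq, isRLW_flatMap_sort _ (pairwise_readingOrder _)]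
  have h : ∀ c x, countBefore (readingOrder ((cells.sup fun c => max c.1 c.2) + 1)).toFinset
      T.entry c x = countBefore cells T.entry c x := by
    intro c x
    unfold countBefore
    congr 1
    ext c
    simp only [Finset.mem_filter, List.mem_toFinset]
    exact ⟨fun h => ⟨T.mem_cells_of_mem_entry h.2.2, h.2⟩,
      fun h => ⟨mem_readingOrder_of_mem h.1, h.2⟩⟩
  simp only [h]
  exact ⟨fun H c k hk => H c (mem_readingOrder_of_mem (T.mem_cells_of_mem_entry hk)) k hk,
    fun H c _ k hk => H c k hk⟩

end SVT

/-! ### Littlewood–Richardson fillings of the second factor -/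

/-- Set-valued tableaux `U` of shape `μ` whose reverse reading word, appended to the content `λ`,
stays a partition at every step. -/
structure LRFilling (lam mu : YoungDiagram) (U : ℕ × ℕ → Finset ℕ) : Prop where
  nonempty : ∀ c ∈ mu.cells, (U c).Nonempty
  mem_of_mem : ∀ c, ∀ x ∈ U c, c ∈ mu.cells
  row : ∀ i j j', j < j' → ∀ a ∈ U (i, j), ∀ b ∈ U (i, j'), a ≤ b
  col : ∀ i i' j, i < i' → ∀ a ∈ U (i, j), ∀ b ∈ U (i', j), a < b
  lattice : ∀ c k, k + 1 ∈ U c →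
    lam.rowLen (k + 1) + countBefore mu.cells U c (k + 1) + 1 ≤
      lam.rowLen k + countBefore mu.cells U c k

theorem YoungDiagram.mem_cells_iff_lt_rowLen {mu : YoungDiagram} {i j : ℕ} :
    (i, j) ∈ mu.cells ↔ j < mu.rowLen i := by
  rw [YoungDiagram.mem_cells, YoungDiagram.mem_iff_lt_rowLen]

theorem YoungDiagram.mem_cells_iff_lt_colLen {mu : YoungDiagram} {i j : ℕ} :
    (i, j) ∈ mu.cells ↔ i < mu.colLen j := by
  rw [YoungDiagram.mem_cells, YoungDiagram.mem_iff_lt_colLen]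

theorem YoungDiagram.mem_cells_of_le {mu : YoungDiagram} {i i' j j' : ℕ}
    (h : (i', j') ∈ mu.cells) (hi : i ≤ i') (hj : j ≤ j') : (i, j) ∈ mu.cells :=
  mu.up_left_mem hi hj h

theorem YoungDiagram.row_le_of_adjacent {mu : YoungDiagram} {U : ℕ × ℕ → Finset ℕ}
    (hne : ∀ c ∈ mu.cells, (U c).Nonempty) (hmem : ∀ c, ∀ x ∈ U c, c ∈ mu.cells)
    (hrow : ∀ i j, ∀ a ∈ U (i, j), ∀ b ∈ U (i, j + 1), a ≤ b) (i j j' : ℕ) (h : j < j') :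
    ∀ a ∈ U (i, j), ∀ b ∈ U (i, j'), a ≤ b := by
  induction j', h using Nat.le_induction with
  | base => exact hrow i j
  | succ n hn ih =>
    intro a ha b hb
    obtain ⟨x, hx⟩ := hne (i, n) (mem_cells_of_le (hmem _ _ hb) le_rfl (by omega))
    exact (ih a ha x hx).trans (hrow i n x hx b hb)

theorem YoungDiagram.col_lt_of_adjacent {mu : YoungDiagram} {U : ℕ × ℕ → Finset ℕ}
    (hne : ∀ c ∈ mu.cells, (U c).Nonempty) (hmem : ∀ c, ∀ x ∈ U c, c ∈ mu.cells)
    (hcol : ∀ i j, ∀ a ∈ U (i, j), ∀ b ∈ U (i + 1, j), a < b) (i i' j : ℕ) (h : i < i') :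
    ∀ a ∈ U (i, j), ∀ b ∈ U (i', j), a < b := by
  induction i', h using Nat.le_induction with
  | base => exact hcol i j
  | succ n hn ih =>
    intro a ha b hb
    obtain ⟨x, hx⟩ := hne (n, j) (mem_cells_of_le (hmem _ _ hb) (by omega) le_rfl)
    exact (ih a ha x hx).trans (hcol n j x hx b hb)

/-- The entries of a straight shape are at least their row index. -/
theorem YoungDiagram.row_le_entry {mu : YoungDiagram} {U : ℕ × ℕ → Finset ℕ}
    (hne : ∀ c ∈ mu.cells, (U c).Nonempty) (hmem : ∀ c, ∀ x ∈ U c, c ∈ mu.cells)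
    (hcol : ∀ i i' j, i < i' → ∀ a ∈ U (i, j), ∀ b ∈ U (i', j), a < b) (i j : ℕ) :
    ∀ x ∈ U (i, j), i ≤ x := by
  induction i with
  | zero => simp
  | succ i ih =>
    intro x hx
    obtain ⟨y, hy⟩ := hne (i, j) (mem_cells_of_le (hmem _ _ hx) (by omega) le_rfl)
    exact (ih y hy).trans_lt (hcol i _ j (by omega) y hy x hx)

/-- A box preceding a box containing `k + 1` and containing `k` lies strictly above it. -/
theorem YoungDiagram.above_of_precedes {mu : YoungDiagram} {U : ℕ × ℕ → Finset ℕ}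
    (hne : ∀ c ∈ mu.cells, (U c).Nonempty) (hmem : ∀ c, ∀ x ∈ U c, c ∈ mu.cells)
    (hrow : ∀ i j j', j < j' → ∀ a ∈ U (i, j), ∀ b ∈ U (i, j'), a ≤ b)
    (hcol : ∀ i i' j, i < i' → ∀ a ∈ U (i, j), ∀ b ∈ U (i', j), a < b)
    {i j i' j' k x : ℕ} (hx : x ∈ U (i, j)) (hkx : k < x) (hk : k ∈ U (i', j'))
    (hp : Precedes (i', j') (i, j)) : i' < i := by
  rcases hp with hp | ⟨-, hp⟩
  · simp only at hp
    by_contra! hi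
    obtain ⟨y, hy⟩ := hne (i, j') (mem_cells_of_le (hmem _ _ hk) hi le_rfl)
    have h1 := hrow i j j' hp x hx y hy
    rcases hi.eq_or_lt with rfl | hi
    · have := hrow i j j' hp x hx k hk
      omega
    · have := hcol i i' j' hi y hy k hk
      omega
  · exact hp

/-- A set-valued tableau of straight shape with lattice word is superstandard. -/
theorem YoungDiagram.superstandard_of_lattice {mu : YoungDiagram} {U : ℕ × ℕ → Finset ℕ}
    (hne : ∀ c ∈ mu.cells, (U c).Nonempty) (hmem : ∀ c, ∀ x ∈ U c, c ∈ mu.cells)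
    (hrow : ∀ i j j', j < j' → ∀ a ∈ U (i, j), ∀ b ∈ U (i, j'), a ≤ b)
    (hcol : ∀ i i' j, i < i' → ∀ a ∈ U (i, j), ∀ b ∈ U (i', j), a < b)
    (hlat : ∀ c k, k + 1 ∈ U c → ∃ c', Precedes c' c ∧ k ∈ U c') (i j : ℕ) :
    ∀ x ∈ U (i, j), x = i := by
  induction i using Nat.strong_induction_on generalizing j with
  | _ i ih =>
    intro x hx
    have hge := row_le_entry hne hmem hcol i j x hx
    rcases hge.eq_or_lt with h | h
    · exact h.symm
    · obtain ⟨k, rfl⟩ : ∃ k, x = k + 1 := ⟨x - 1, by omega⟩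
      obtain ⟨⟨i', j'⟩, hp, hk⟩ := hlat _ _ hx
      have h' := above_of_precedes hne hmem hrow hcol hx (by omega) hk hp
      have := ih i' h' j' k hk
      omega

namespace LRFilling

variable {lam mu : YoungDiagram} {U U' : ℕ × ℕ → Finset ℕ}

theorem row_le_entry (h : LRFilling lam mu U) {i j x : ℕ} (hx : x ∈ U (i, j)) : i ≤ x :=
  YoungDiagram.row_le_entry h.nonempty h.mem_of_mem h.col i j x hx

theorem above_of_precedes (h : LRFilling lam mu U) {i j i' j' k x : ℕ} (hx : x ∈ U (i, j))
    (hkx : k < x) (hk : k ∈ U (i', j')) (hp : Precedes (i', j') (i, j)) : i' < i :=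
  YoungDiagram.above_of_precedes h.nonempty h.mem_of_mem h.row h.col hx hkx hk hp

end LRFilling

/-! ### Tableaux on the corner-to-corner shape -/

/-- The filling of `λ * μ` given by the superstandard tableau on `λ` and by `U` on `μ`. -/
def starEntry (lam mu : YoungDiagram) (U : ℕ × ℕ → Finset ℕ) (c : ℕ × ℕ) : Finset ℕ :=
  if c.1 < lam.colLen 0 then
    if mu.rowLen 0 ≤ c.2 ∧ (c.1, c.2 - mu.rowLen 0) ∈ lam.cells then {c.1} else ∅
  else U (c.1 - lam.colLen 0, c.2)

theorem mem_starCells {lam mu : YoungDiagram} {i j : ℕ} :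
    (i, j) ∈ starCells lam mu ↔
      (i < lam.colLen 0 ∧ mu.rowLen 0 ≤ j ∧ (i, j - mu.rowLen 0) ∈ lam.cells) ∨
      (lam.colLen 0 ≤ i ∧ (i - lam.colLen 0, j) ∈ mu.cells) := by
  simp only [starCells, Finset.mem_union, Finset.mem_image, Prod.mk.injEq]
  constructor
  · rintro (⟨⟨a, b⟩, h, rfl, rfl⟩ | ⟨⟨a, b⟩, h, rfl, rfl⟩)
    · refine Or.inl ⟨?_, by simp, by simpa using h⟩
      exact YoungDiagram.mem_cells_iff_lt_colLen.mp
        (YoungDiagram.mem_cells_of_le h le_rfl (Nat.zero_le _))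
    · exact Or.inr ⟨by simp, by simpa using h⟩
  · rintro (⟨-, h1, h2⟩ | ⟨h1, h2⟩)
    · exact Or.inl ⟨_, h2, rfl, by simp only; omega⟩
    · exact Or.inr ⟨_, h2, by simp only; omega, rfl⟩

theorem lt_rowLen_zero_of_mem {mu : YoungDiagram} {i j : ℕ} (h : (i, j) ∈ mu.cells) :
    j < mu.rowLen 0 :=
  YoungDiagram.mem_cells_iff_lt_rowLen.mp (YoungDiagram.mem_cells_of_le h (Nat.zero_le _) le_rfl)

theorem lt_colLen_zero_of_mem {mu : YoungDiagram} {i j : ℕ} (h : (i, j) ∈ mu.cells) :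
    i < mu.colLen 0 :=
  YoungDiagram.mem_cells_iff_lt_colLen.mp (YoungDiagram.mem_cells_of_le h le_rfl (Nat.zero_le _))

theorem card_filter_fst (lam : YoungDiagram) (x : ℕ) :
    (lam.cells.filter fun c => c.1 = x).card = lam.rowLen x := by
  rw [YoungDiagram.rowLen_eq_card, YoungDiagram.row]

theorem card_filter_starCells (lam mu : YoungDiagram) (p : ℕ × ℕ → Prop) [DecidablePred p] :
    ((starCells lam mu).filter p).card =
      (lam.cells.filter fun c => p (c.1, c.2 + mu.rowLen 0)).card +
        (mu.cells.filter fun c => p (c.1 + lam.colLen 0, c.2)).card := by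
  rw [starCells, Finset.filter_union, Finset.card_union_of_disjoint, Finset.filter_image,
    Finset.filter_image, Finset.card_image_of_injective, Finset.card_image_of_injective]
  · rintro ⟨a, b⟩ ⟨c, d⟩ h
    simpa using h
  · rintro ⟨a, b⟩ ⟨c, d⟩ h
    simpa using h
  · apply Finset.disjoint_filter_filter
    rw [Finset.disjoint_left]
    simp only [Finset.mem_image]
    rintro _ ⟨⟨a, b⟩, h, rfl⟩ ⟨⟨c, d⟩, h', he⟩
    have := lt_rowLen_zero_of_mem h'
    simp only [Prod.mk.injEq] at he
    omega

theorem countAll_starCells {lam mu : YoungDiagram} {V : ℕ × ℕ → Finset ℕ}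
    (hV : ∀ i j x, (i, j) ∈ lam.cells → (x ∈ V (i, j + mu.rowLen 0) ↔ x = i)) (x : ℕ) :
    countAll (starCells lam mu) V x =
      lam.rowLen x + countAll mu.cells (fun c => V (c.1 + lam.colLen 0, c.2)) x := by
  rw [countAll, card_filter_starCells, countAll, ← card_filter_fst lam x]
  congr 2
  refine Finset.filter_congr ?_
  rintro ⟨i, j⟩ h
  simp only [hV i j x h, eq_comm]

theorem countBefore_starCells {lam mu : YoungDiagram} {V : ℕ × ℕ → Finset ℕ}
    (hV : ∀ i j x, (i, j) ∈ lam.cells → (x ∈ V (i, j + mu.rowLen 0) ↔ x = i)) {i j : ℕ}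
    (hj : j < mu.rowLen 0) (x : ℕ) :
    countBefore (starCells lam mu) V (i + lam.colLen 0, j) x =
      lam.rowLen x + countBefore mu.cells (fun c => V (c.1 + lam.colLen 0, c.2)) (i, j) x := by
  rw [countBefore, card_filter_starCells, countBefore, ← card_filter_fst lam x]
  congr 2
  · refine Finset.filter_congr ?_
    rintro ⟨i', j'⟩ h
    simp only [hV i' j' x h, eq_comm, and_iff_right_iff_imp]
    rintro -
    exact Or.inl (by simp only; omega)
  · refine Finset.filter_congr ?_
    rintro ⟨i', j'⟩ h
    simp [Precedes]

theorem starEntry_left {lam mu : YoungDiagram} (U : ℕ × ℕ → Finset ℕ) (i j x : ℕ)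
    (h : (i, j) ∈ lam.cells) : x ∈ starEntry lam mu U (i, j + mu.rowLen 0) ↔ x = i := by
  simp [starEntry, lt_colLen_zero_of_mem h, -YoungDiagram.mem_cells, h]

theorem starEntry_right {lam mu : YoungDiagram} (U : ℕ × ℕ → Finset ℕ) (c : ℕ × ℕ) :
    starEntry lam mu U (c.1 + lam.colLen 0, c.2) = U c := by
  simp [starEntry]

namespace LRFilling

variable {lam mu : YoungDiagram} {U U' : ℕ × ℕ → Finset ℕ}

/-- The tableau of shape `λ * μ` corresponding to a filling of `μ`. -/
def starSVT (h : LRFilling lam mu U) : SVT (starCells lam mu) where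
  entry := starEntry lam mu U
  nonempty_of_mem := by
    rintro ⟨i, j⟩ hc
    rcases mem_starCells.mp hc with ⟨h1, h2, h3⟩ | ⟨h1, h2⟩
    · rw [starEntry, if_pos h1, if_pos ⟨h2, h3⟩]; simp
    · rw [starEntry, if_neg (by simpa using h1)]; exact h.nonempty _ h2
  eq_empty_of_not_mem := by
    rintro ⟨i, j⟩ hc
    rw [mem_starCells] at hc
    unfold starEntry
    split_ifs with h1 h2
    · exact absurd (Or.inl ⟨h1, h2⟩) hc
    · rfl
    · rw [Finset.eq_empty_iff_forall_notMem]
      exact fun x hx => hc (Or.inr ⟨by simpa using h1, h.mem_of_mem _ x hx⟩)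
  row_weak := by
    intro i j _ _ a ha b hb
    unfold starEntry at ha hb
    split_ifs at ha hb <;> simp_all
    exact h.row _ _ _ (by omega) a ha b hb
  col_strict := by
    intro i j _ _ a ha b hb
    unfold starEntry at ha hb
    simp only at ha hb
    split_ifs at ha hb with h1 h2 h3 h4 h5 h6
    · simp_all
    · simp at hb
    · have := lt_rowLen_zero_of_mem (h.mem_of_mem _ _ hb)
      omega
    · simp at ha
    · simp at ha
    · simp at ha
    · omega
    · simp at hb
    · exact h.col _ _ _ (by omega) a ha b hb

theorem isRLW_starSVT (h : LRFilling lam mu U) : IsRLW h.starSVT.word := by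
  rw [SVT.isRLW_word_iff]
  rintro ⟨i, j⟩ k hk
  change k + 1 ∈ starEntry lam mu U (i, j) at hk
  change countBefore _ (starEntry lam mu U) _ _ + 1 ≤ countBefore _ (starEntry lam mu U) _ _
  by_cases hi : i < lam.colLen 0
  · rw [starEntry, if_pos hi] at hk
    split_ifs at hk with h2
    · obtain rfl : k + 1 = i := by simpa using hk
      rw [Nat.succ_le_iff]
      have hc : ∀ x, countBefore (starCells lam mu) (starEntry lam mu U) (k + 1, j) x =
          (lam.cells.filter fun c => Precedes (c.1, c.2 + mu.rowLen 0) (k + 1, j) ∧ c.1 = x).card := by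
        intro x
        rw [countBefore, card_filter_starCells, add_eq_left.mpr]
        · congr 1
          refine Finset.filter_congr ?_
          rintro ⟨a, b⟩ hab
          simp only [starEntry_left U a b x hab, eq_comm]
        · rw [Finset.card_eq_zero, Finset.filter_eq_empty_iff]
          rintro ⟨a, b⟩ hab ⟨hp, -⟩
          have := lt_rowLen_zero_of_mem hab
          unfold Precedes at hp
          simp only at hp
          omega
      rw [hc, hc]
      have hinj : Set.InjOn (fun c : ℕ × ℕ => (k, c.2)) (lam.cells.filter fun c =>
          Precedes (c.1, c.2 + mu.rowLen 0) (k + 1, j) ∧ c.1 = k + 1) := by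
        rintro ⟨a, b⟩ hab ⟨a', b'⟩ hab' he
        simp only [Finset.coe_filter, Set.mem_ofPred_eq] at hab hab'
        simp only [Prod.mk.injEq, true_and] at he
        exact Prod.ext (hab.2.2.trans hab'.2.2.symm) he
      rw [← Finset.card_image_of_injOn hinj]
      apply Finset.card_lt_card
      rw [Finset.ssubset_iff_of_subset]
      · refine ⟨(k, j - mu.rowLen 0), ?_, ?_⟩
        · rw [Finset.mem_filter]
          exact ⟨YoungDiagram.mem_cells_of_le h2.2 (Nat.le_succ k) le_rfl,
            Or.inr ⟨by simp only; omega, Nat.lt_succ_self k⟩, rfl⟩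
        · simp only [Finset.mem_image, Finset.mem_filter, not_exists, not_and, Prod.mk.injEq,
            true_and]
          rintro ⟨a, b⟩ ⟨-, hp, ha⟩ hb
          unfold Precedes at hp
          simp only at hp ha hb
          omega
      · intro c
        simp only [Finset.mem_image, Finset.mem_filter]
        rintro ⟨⟨a, b⟩, ⟨hab, hp, ha⟩, rfl⟩
        simp only at ha
        subst ha
        refine ⟨YoungDiagram.mem_cells_of_le hab (Nat.le_succ k) le_rfl, ?_, rfl⟩
        unfold Precedes at hp ⊢
        simp only at hp ⊢
        omega
    · simp at hk
  · obtain ⟨i, rfl⟩ : ∃ i', i = i' + lam.colLen 0 := ⟨i - lam.colLen 0, by omega⟩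
    have hk' := hk
    rw [starEntry_right U (i, j)] at hk'
    have hj := lt_rowLen_zero_of_mem (h.mem_of_mem _ _ hk')
    rw [countBefore_starCells (starEntry_left U) hj, countBefore_starCells (starEntry_left U) hj]
    simp only [starEntry_right]
    exact h.lattice _ _ hk'

theorem count_word_starSVT (h : LRFilling lam mu U) (x : ℕ) :
    h.starSVT.word.count x = lam.rowLen x + countAll mu.cells U x := by
  rw [SVT.count_word]
  change countAll _ (starEntry lam mu U) _ = _
  rw [countAll_starCells (starEntry_left U)]
  simp only [starEntry_right]

end LRFilling

namespace SVT

variable {lam mu : YoungDiagram}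

theorem starCells_left (T : SVT (starCells lam mu)) (hT : IsRLW T.word) (i j x : ℕ)
    (hc : (i, j) ∈ lam.cells) : x ∈ T.entry (i, j + mu.rowLen 0) ↔ x = i := by
  rw [isRLW_word_iff] at hT
  have hstar : ∀ c ∈ lam.cells, (c.1, c.2 + mu.rowLen 0) ∈ starCells lam mu := fun c hc =>
    mem_starCells.mpr (Or.inl ⟨lt_colLen_zero_of_mem hc, by omega, by simpa using hc⟩)
  let V : ℕ × ℕ → Finset ℕ := fun c =>
    if c ∈ lam.cells then T.entry (c.1, c.2 + mu.rowLen 0) else ∅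
  have hV : ∀ c x, x ∈ V c ↔ c ∈ lam.cells ∧ x ∈ T.entry (c.1, c.2 + mu.rowLen 0) := by
    intro c x
    simp only [V]
    split_ifs with h <;> simp [h, -YoungDiagram.mem_cells]
  have hne : ∀ c ∈ lam.cells, (V c).Nonempty := by
    intro c hc
    obtain ⟨y, hy⟩ := T.nonempty_of_mem _ (hstar c hc)
    exact ⟨y, (hV c y).mpr ⟨hc, hy⟩⟩
  have hmem : ∀ c, ∀ x ∈ V c, c ∈ lam.cells := fun c x hx => ((hV c x).mp hx).1
  have hsup := YoungDiagram.superstandard_of_lattice hne hmem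
    (YoungDiagram.row_le_of_adjacent hne hmem fun i j a ha b hb => by
      rw [hV] at ha hb
      have h := T.row_weak i (j + mu.rowLen 0) (hstar _ ha.1)
      rw [add_right_comm] at h
      exact h (hstar _ hb.1) a ha.2 b hb.2)
    (YoungDiagram.col_lt_of_adjacent hne hmem fun i j a ha b hb => by
      rw [hV] at ha hb
      exact T.col_strict i (j + mu.rowLen 0) (hstar _ ha.1) (hstar _ hb.1) a ha.2 b hb.2)
    (by
      rintro ⟨i, j⟩ k hk
      rw [hV] at hk
      have h := hT _ _ hk.2
      obtain ⟨⟨i', j'⟩, hc'⟩ := Finset.card_pos.mp (lt_of_lt_of_le (Nat.succ_pos _) h)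
      rw [Finset.mem_filter] at hc'
      obtain ⟨h1, hp, hk'⟩ := hc'
      rcases mem_starCells.mp h1 with ⟨h2, h3, h4⟩ | ⟨h2, h3⟩
      · refine ⟨(i', j' - mu.rowLen 0), ?_, (hV _ _).mpr ⟨h4, ?_⟩⟩
        · unfold Precedes at hp ⊢
          simp only at hp ⊢
          omega
        · simpa [h3] using hk'
      · have := lt_rowLen_zero_of_mem h3
        unfold Precedes at hp
        simp only at hp
        omega) i j
  constructor
  · exact fun hx => hsup x ((hV _ _).mpr ⟨hc, hx⟩)
  · rintro rfl
    obtain ⟨y, hy⟩ := hne _ hc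
    obtain rfl := hsup y hy
    exact ((hV _ _).mp hy).2

theorem lrFilling (T : SVT (starCells lam mu)) (hT : IsRLW T.word) :
    LRFilling lam mu fun c => T.entry (c.1 + lam.colLen 0, c.2) := by
  have hstar : ∀ c : ℕ × ℕ, (c.1 + lam.colLen 0, c.2) ∈ starCells lam mu ↔ c ∈ mu.cells := by
    intro c
    rw [mem_starCells]
    constructor
    · rintro (h | h)
      · omega
      · simpa using h.2
    · exact fun h => Or.inr ⟨by omega, by simpa using h⟩
  have hne : ∀ c ∈ mu.cells, (T.entry (c.1 + lam.colLen 0, c.2)).Nonempty :=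
    fun c hc => T.nonempty_of_mem _ ((hstar c).mpr hc)
  have hmem : ∀ c : ℕ × ℕ, ∀ x ∈ T.entry (c.1 + lam.colLen 0, c.2), c ∈ mu.cells :=
    fun c x hx => (hstar c).mp (T.mem_cells_of_mem_entry hx)
  refine ⟨hne, hmem, ?_, ?_, ?_⟩
  · exact YoungDiagram.row_le_of_adjacent hne hmem fun i j a ha b hb =>
      T.row_weak _ _ (T.mem_cells_of_mem_entry ha) (T.mem_cells_of_mem_entry hb) a ha b hb
  · refine YoungDiagram.col_lt_of_adjacent hne hmem fun i j a ha b hb => ?_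
    simp only at ha hb
    rw [add_right_comm] at hb
    exact T.col_strict _ _ (T.mem_cells_of_mem_entry ha) (T.mem_cells_of_mem_entry hb) a ha b hb
  · rintro ⟨i, j⟩ k hk
    have h := (isRLW_word_iff T).mp hT _ _ hk
    have hj := lt_rowLen_zero_of_mem (hmem (i, j) _ hk)
    simp only at h
    rwa [countBefore_starCells (T.starCells_left hT) hj,
      countBefore_starCells (T.starCells_left hT) hj] at h

theorem count_word_of_isRLW (T : SVT (starCells lam mu)) (hT : IsRLW T.word) (x : ℕ) :
    T.word.count x = lam.rowLen x +
      countAll mu.cells (fun c => T.entry (c.1 + lam.colLen 0, c.2)) x := by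
  rw [count_word, countAll_starCells (T.starCells_left hT)]

theorem eq_of_entry_right_eq (T T' : SVT (starCells lam mu)) (hT : IsRLW T.word)
    (hT' : IsRLW T'.word)
    (h : (fun c : ℕ × ℕ => T.entry (c.1 + lam.colLen 0, c.2)) =
      fun c => T'.entry (c.1 + lam.colLen 0, c.2)) : T = T' := by
  apply ext_entry
  funext ⟨i, j⟩
  by_cases hc : (i, j) ∈ starCells lam mu
  · rcases mem_starCells.mp hc with ⟨-, h1, h2⟩ | ⟨h1, -⟩
    · ext x
      have e := T.starCells_left hT _ _ x h2
      have e' := T'.starCells_left hT' _ _ x h2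
      rw [Nat.sub_add_cancel h1] at e e'
      rw [e, e']
    · have := congrFun h (i - lam.colLen 0, j)
      simpa [h1] using this
  · rw [T.eq_empty_of_not_mem _ hc, T'.eq_empty_of_not_mem _ hc]

theorem finite_hasContent (cells : Finset (ℕ × ℕ)) (nu : YoungDiagram) :
    Finite {T : SVT cells // IsRLW T.word ∧ HasContent T.word nu} := by
  have hb : ∀ T : {T : SVT cells // IsRLW T.word ∧ HasContent T.word nu}, ∀ c,
      T.1.entry c ∈ (Finset.range (nu.colLen 0)).powerset := by
    rintro ⟨T, -, hT⟩ c
    rw [Finset.mem_powerset]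
    intro x hx
    have h := hT x
    rw [count_word] at h
    rw [Finset.mem_range, ← YoungDiagram.mem_iff_lt_colLen, YoungDiagram.mem_iff_lt_rowLen, ← h,
      countAll, Finset.card_pos]
    exact ⟨c, Finset.mem_filter.mpr ⟨T.mem_cells_of_mem_entry hx, hx⟩⟩
  refine Finite.of_injective (β := cells → (Finset.range (nu.colLen 0)).powerset)
    (fun T c => ⟨T.1.entry c, hb T c⟩) ?_
  intro T T' h
  apply Subtype.ext
  apply ext_entry
  funext c
  by_cases hc : c ∈ cells
  · simpa using congrFun h ⟨c, hc⟩
  · rw [T.1.eq_empty_of_not_mem _ hc, T'.1.eq_empty_of_not_mem _ hc]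

end SVT

/-- A weakly decreasing, eventually zero sequence is the sequence of row lengths of a diagram. -/
theorem exists_youngDiagram_rowLen (f : ℕ → ℕ) (hf : Antitone f) (N : ℕ) (hN : f N = 0) :
    ∃ nu : YoungDiagram, ∀ i, nu.rowLen i = f i := by
  let nu : YoungDiagram :=
    ⟨(Finset.range N ×ˢ Finset.range (f 0)).filter fun c => c.2 < f c.1, by
      rintro ⟨i, j⟩ ⟨i', j'⟩ ⟨h1, h2⟩ h
      simp only [Finset.coe_filter, Finset.mem_product, Finset.mem_range, Set.mem_ofPred_eq] at h ⊢
      have := hf h1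
      simp only at h1 h2 this
      omega⟩
  refine ⟨nu, fun i => ?_⟩
  have h : ∀ j, j < nu.rowLen i ↔ j < f i := by
    intro j
    rw [← YoungDiagram.mem_cells_iff_lt_rowLen]
    simp only [nu, Finset.mem_filter, Finset.mem_product, Finset.mem_range, and_iff_right_iff_imp]
    intro hj
    have h0 := hf (Nat.zero_le i)
    refine ⟨?_, by omega⟩
    by_contra! hi
    have := hf hi
    omega
  have h1 := h (nu.rowLen i)
  have h2 := h (f i)
  omega

theorem multiplicityFree_iff_lrFilling (lam mu : YoungDiagram) :
    (∀ nu : YoungDiagram, cLR lam mu nu = -1 ∨ cLR lam mu nu = 0 ∨ cLR lam mu nu = 1) ↔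
      ∀ U U', LRFilling lam mu U → LRFilling lam mu U' →
        (∀ x, countAll mu.cells U x = countAll mu.cells U' x) → U = U' := by
  have hcard : ∀ nu : YoungDiagram,
      (cLR lam mu nu = -1 ∨ cLR lam mu nu = 0 ∨ cLR lam mu nu = 1) ↔
        Subsingleton {T : SVT (starCells lam mu) // IsRLW T.word ∧ HasContent T.word nu} := by
    intro nu
    have := SVT.finite_hasContent (starCells lam mu) nu
    rw [← Finite.card_le_one_iff_subsingleton, cLR]
    rcases neg_one_pow_eq_or ℤ (nu.card - lam.card - mu.card) with h | h <;> rw [h] <;> omega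
  simp only [hcard]
  constructor
  · intro H U U' h h' hc
    have hcount : ∀ x, h.starSVT.word.count x = h'.starSVT.word.count x := by
      intro x
      rw [h.count_word_starSVT, h'.count_word_starSVT, hc]
    obtain ⟨nu, hnu⟩ := exists_youngDiagram_rowLen (fun x => h.starSVT.word.count x)
      (antitone_nat_of_succ_le fun k => h.isRLW_starSVT _ List.suffix_rfl k)
      (h.starSVT.word.sum + 1) (by
        rw [List.count_eq_zero]
        intro hm
        have := List.le_sum_of_mem hm
        omega)
    have he := @Subsingleton.elim _ (H nu)
      ⟨h.starSVT, h.isRLW_starSVT, fun i => (hnu i).symm⟩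
      ⟨h'.starSVT, h'.isRLW_starSVT, fun i => ((hnu i).trans (hcount i)).symm⟩
    have he' : starEntry lam mu U = starEntry lam mu U' :=
      congrArg SVT.entry (congrArg Subtype.val he)
    funext c
    rw [← starEntry_right (lam := lam) (mu := mu) U c, he', starEntry_right]
  · rintro H nu
    refine ⟨?_⟩
    rintro ⟨T, hT, hc⟩ ⟨T', hT', hc'⟩
    apply Subtype.ext
    refine T.eq_of_entry_right_eq T' hT hT' (H _ _ (T.lrFilling hT) (T'.lrFilling hT') fun x => ?_)
    have h := T.count_word_of_isRLW hT x
    have h' := T'.count_word_of_isRLW hT' x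
    rw [hc x] at h
    rw [hc' x] at h'
    omega

/-! ### Multiplicity-free products -/

/-- Sets of naturals that are comparable and equinumerous coincide; comparability holds when both
are initial (or both final) segments of the same interval. -/
theorem Finset.eq_of_segments {S S' : Finset ℕ} (r : ℕ → ℕ → Prop)
    (hr : ∀ a b, a ≠ b → r a b ∨ r b a) (hS : ∀ a ∈ S, ∀ b ∈ S ∪ S', r b a → b ∈ S)
    (hS' : ∀ a ∈ S', ∀ b ∈ S ∪ S', r b a → b ∈ S') (hc : S.card = S'.card) : S = S' := by
  have h : S ⊆ S' ∨ S' ⊆ S := by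
    by_contra! h
    rw [Finset.not_subset, Finset.not_subset] at h
    obtain ⟨⟨x, hx, hx'⟩, y, hy, hy'⟩ := h
    rcases hr x y (by rintro rfl; exact hx' hy) with h | h
    · exact hx' (hS' y hy x (Finset.mem_union_left _ hx) h)
    · exact hy' (hS x hx y (Finset.mem_union_right _ hy) h)
  rcases h with h | h
  · exact Finset.eq_of_subset_of_card_le h hc.ge
  · exact (Finset.eq_of_subset_of_card_le h hc.le).symm

namespace LRFilling

variable {lam mu : YoungDiagram} {U U' : ℕ × ℕ → Finset ℕ}

theorem countBefore_lt (h : LRFilling lam mu U) {c : ℕ × ℕ} {k : ℕ} (hk : k + 1 ∈ U c)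
    (hl : lam.rowLen k ≤ lam.rowLen (k + 1)) :
    countBefore mu.cells U c (k + 1) < countBefore mu.cells U c k := by
  have := h.lattice c k hk
  omega

theorem exists_precedes (h : LRFilling lam mu U) {c : ℕ × ℕ} {k : ℕ} (hk : k + 1 ∈ U c)
    (hl : lam.rowLen k ≤ lam.rowLen (k + 1)) : ∃ c', Precedes c' c ∧ k ∈ U c' := by
  obtain ⟨c', hc'⟩ := Finset.card_pos.mp (Nat.zero_lt_of_lt (h.countBefore_lt hk hl))
  exact ⟨c', (Finset.mem_filter.mp hc').2⟩

section Rectangular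

variable {a b n d : ℕ}

theorem small_eq_row (h : LRFilling lam mu U) (hlam : ∀ k, lam.rowLen k = if k < b then a else 0)
    (i j : ℕ) : ∀ x ∈ U (i, j), x < b → x = i := by
  induction i using Nat.strong_induction_on generalizing j with
  | _ i ih =>
    intro x hx hxb
    rcases (h.row_le_entry hx).eq_or_lt with e | hlt
    · exact e.symm
    · obtain ⟨k, rfl⟩ : ∃ k, x = k + 1 := ⟨x - 1, by omega⟩
      obtain ⟨⟨i', j'⟩, hp, hk⟩ := h.exists_precedes hx
        (by rw [hlam, hlam, if_pos (by omega), if_pos hxb])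
      have h' := h.above_of_precedes hx (by omega) hk hp
      have := ih i' h' j' k hk (by omega)
      omega

theorem large_pred (h : LRFilling lam mu U) (hlam : ∀ k, lam.rowLen k = if k < b then a else 0)
    (hmu : ∀ i j, (i, j) ∈ mu.cells ↔ i < d ∧ j < n) (j : ℕ) :
    ∀ i k, b ≤ k → k + 1 ∈ U (i, j) → ∃ i', i = i' + 1 ∧ k ∈ U (i', j) := by
  induction hm : n - j using Nat.strong_induction_on generalizing j with
  | _ m ih =>
    subst hm
    intro i k hbk hk
    have hij := (hmu i j).mp (h.mem_of_mem _ _ hk)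
    have hlt := h.countBefore_lt hk
      (by rw [hlam, hlam, if_neg (by omega), if_neg (by omega)])
    by_contra hcon
    refine absurd hlt (not_lt.mpr ?_)
    refine Finset.card_le_card_of_injOn (fun c => (c.1 + 1, c.2)) ?_ ?_
    · rintro ⟨i', j'⟩ hc
      simp only [Finset.coe_filter, Set.mem_ofPred_eq] at hc ⊢
      obtain ⟨hc, hp, hk'⟩ := hc
      have hjj : j < j' := by
        rcases hp with hp | ⟨hp, hp'⟩
        · exact hp
        · simp only at hp hp'
          subst hp
          exfalso
          obtain ⟨i0, rfl⟩ : ∃ i0, i = i0 + 1 := ⟨i - 1, by omega⟩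
          rcases Nat.lt_succ_iff.mp hp' |>.eq_or_lt with rfl | h3
          · exact hcon ⟨_, rfl, hk'⟩
          · obtain ⟨y, hy⟩ := h.nonempty (i0, j') ((hmu _ _).mpr ⟨by omega, hij.2⟩)
            have h1 := h.col i' i0 j' h3 k hk' y hy
            have h2 := h.col i0 (i0 + 1) j' (by omega) y hy (k + 1) hk
            omega
      have hc1 := (hmu _ _).mp hc
      have hd : i' < d - 1 := by
        by_contra! hd
        have := h.above_of_precedes hk (by omega) hk' hp
        omega
      have hc2 : (i' + 1, j') ∈ mu.cells := (hmu _ _).mpr ⟨by omega, hc1.2⟩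
      obtain ⟨y, hy⟩ := h.nonempty _ hc2
      have h1 := h.col i' (i' + 1) j' (by omega) k hk' y hy
      have hy1 : y = k + 1 := by
        by_contra hne
        obtain ⟨z, rfl⟩ : ∃ z, y = z + 1 + 1 := ⟨y - 2, by omega⟩
        obtain ⟨i2, h2, h3⟩ := ih (n - j') (by omega) j' rfl (i' + 1) (z + 1) (by omega) hy
        obtain rfl : i' = i2 := by omega
        obtain ⟨i3, rfl, h5⟩ := ih (n - j') (by omega) j' rfl i' z (by omega) h3
        have := h.col i3 (i3 + 1) j' (by omega) z h5 k hk'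
        omega
      subst hy1
      exact ⟨hc2, Or.inl hjj, hy⟩
    · rintro ⟨i1, j1⟩ _ ⟨i2, j2⟩ _ he
      simpa using he

/-- The number of boxes of column `j` without an entry `≥ b`. -/
def smallHeight (d b : ℕ) (U : ℕ × ℕ → Finset ℕ) (j : ℕ) : ℕ :=
  ((Finset.range d).filter fun i => ∀ x ∈ U (i, j), x < b).card

theorem smallHeight_eq (h : LRFilling lam mu U) (hmu : ∀ i j, (i, j) ∈ mu.cells ↔ i < d ∧ j < n)
    {i j : ℕ} (hi : i ≤ d) (hj : j < n) (hlt : ∀ i' < i, ∀ x ∈ U (i', j), x < b)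
    (hge : i < d → ∃ x ∈ U (i, j), b ≤ x) : smallHeight d b U j = i := by
  rw [smallHeight, ← Finset.card_range i]
  congr 1
  ext i'
  simp only [Finset.mem_filter, Finset.mem_range]
  constructor
  · rintro ⟨hi', hx⟩
    by_contra! hii
    obtain ⟨x, hxU, hbx⟩ := hge (by omega)
    rcases hii.eq_or_lt with rfl | hii
    · exact absurd (hx x hxU) (by omega)
    · obtain ⟨y, hy⟩ := h.nonempty (i', j) ((hmu _ _).mpr ⟨hi', hj⟩)
      have := h.col i i' j hii x hxU y hy
      exact absurd (hx y hy) (by omega)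
  · exact fun hi' => ⟨by omega, hlt i' hi'⟩

theorem large_add_smallHeight (h : LRFilling lam mu U)
    (hlam : ∀ k, lam.rowLen k = if k < b then a else 0)
    (hmu : ∀ i j, (i, j) ∈ mu.cells ↔ i < d ∧ j < n) (y : ℕ) :
    ∀ i j, b + y ∈ U (i, j) → smallHeight d b U j + y = i := by
  induction y with
  | zero =>
    intro i j hx
    have hij := (hmu i j).mp (h.mem_of_mem _ _ hx)
    exact h.smallHeight_eq hmu hij.1.le hij.2
      (fun i' hi' x hx' => h.col i' i j hi' x hx' _ hx) (fun _ => ⟨_, hx, le_rfl⟩)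
  | succ y ih =>
    intro i j hx
    obtain ⟨i', rfl, hx'⟩ := h.large_pred hlam hmu j i (b + y) (by omega) hx
    have := ih i' j hx'
    omega

theorem exists_large (h : LRFilling lam mu U) (hmu : ∀ i j, (i, j) ∈ mu.cells ↔ i < d ∧ j < n)
    {i j : ℕ} (hi : i < d) (hj : j < n) (hs : smallHeight d b U j ≤ i) :
    ∃ y, b + y ∈ U (i, j) := by
  by_contra! hcon
  have hsub : Finset.range (i + 1) ⊆
      (Finset.range d).filter fun i => ∀ x ∈ U (i, j), x < b := by
    intro i' hi'
    rw [Finset.mem_range] at hi'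
    rw [Finset.mem_filter, Finset.mem_range]
    refine ⟨by omega, fun x hx => ?_⟩
    have hlast : ∀ x ∈ U (i, j), x < b := by
      intro x hx
      by_contra! hb
      exact hcon (x - b) (by rwa [Nat.add_sub_cancel' hb])
    rcases (Nat.lt_succ_iff.mp hi').eq_or_lt with rfl | hlt
    · exact hlast x hx
    · obtain ⟨z, hz⟩ := h.nonempty (i, j) ((hmu _ _).mpr ⟨hi, hj⟩)
      exact (h.col i' i j hlt x hx z hz).trans (hlast z hz)
  have := Finset.card_le_card hsub
  rw [Finset.card_range] at this
  unfold smallHeight at hs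
  omega

theorem smallHeight_antitone (h : LRFilling lam mu U)
    (hmu : ∀ i j, (i, j) ∈ mu.cells ↔ i < d ∧ j < n) {j j' : ℕ} (hj : j < j') (hn : j' < n) :
    smallHeight d b U j' ≤ smallHeight d b U j := by
  refine Finset.card_le_card fun i hi => ?_
  rw [Finset.mem_filter, Finset.mem_range] at hi ⊢
  refine ⟨hi.1, fun x hx => ?_⟩
  obtain ⟨z, hz⟩ := h.nonempty (i, j') ((hmu _ _).mpr ⟨hi.1, hn⟩)
  exact (h.row i j j' hj x hx z hz).trans_lt (hi.2 z hz)

theorem countAll_small (h : LRFilling lam mu U)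
    (hlam : ∀ k, lam.rowLen k = if k < b then a else 0)
    (hmu : ∀ i j, (i, j) ∈ mu.cells ↔ i < d ∧ j < n) {i : ℕ} (hi : i < b) :
    countAll mu.cells U i = ((Finset.range n).filter fun j => i ∈ U (i, j)).card := by
  refine (Finset.card_bij (fun j _ => (i, j)) ?_ ?_ ?_).symm
  · intro j hj
    rw [Finset.mem_filter] at hj ⊢
    exact ⟨h.mem_of_mem _ _ hj.2, hj.2⟩
  · simp
  · rintro ⟨i', j⟩ hc
    rw [Finset.mem_filter] at hc
    obtain rfl := h.small_eq_row hlam i' j i hc.2 hi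
    exact ⟨j, Finset.mem_filter.mpr
      ⟨Finset.mem_range.mpr ((hmu _ _).mp hc.1).2, hc.2⟩, rfl⟩

theorem countAll_large (h : LRFilling lam mu U)
    (hlam : ∀ k, lam.rowLen k = if k < b then a else 0)
    (hmu : ∀ i j, (i, j) ∈ mu.cells ↔ i < d ∧ j < n) (y : ℕ) :
    countAll mu.cells U (b + y) =
      ((Finset.range n).filter fun j => smallHeight d b U j + y < d).card := by
  refine (Finset.card_bij (fun j _ => (smallHeight d b U j + y, j)) ?_ ?_ ?_).symm
  · intro j hj
    rw [Finset.mem_filter, Finset.mem_range] at hj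
    rw [Finset.mem_filter]
    obtain ⟨z, hz⟩ := h.exists_large hmu hj.2 hj.1 (Nat.le_add_right _ y)
    have := h.large_add_smallHeight hlam hmu z _ _ hz
    obtain rfl : z = y := by omega
    exact ⟨h.mem_of_mem _ _ hz, hz⟩
  · intro j _ j' _ he
    exact congrArg Prod.snd he
  · rintro ⟨i, j⟩ hc
    rw [Finset.mem_filter] at hc
    have hs := h.large_add_smallHeight hlam hmu y i j hc.2
    have hij := (hmu _ _).mp hc.1
    exact ⟨j, Finset.mem_filter.mpr ⟨Finset.mem_range.mpr hij.2, by omega⟩, by rw [hs]⟩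

theorem smallHeight_unique (h : LRFilling lam mu U) (h' : LRFilling lam mu U')
    (hlam : ∀ k, lam.rowLen k = if k < b then a else 0)
    (hmu : ∀ i j, (i, j) ∈ mu.cells ↔ i < d ∧ j < n)
    (hc : ∀ x, countAll mu.cells U x = countAll mu.cells U' x) {j : ℕ} (hj : j < n) :
    smallHeight d b U j = smallHeight d b U' j := by
  have hle : ∀ V, smallHeight d b V j ≤ d := fun V =>
    (Finset.card_filter_le _ _).trans (Finset.card_range d).le
  have hS : ∀ y, (smallHeight d b U j + y < d ↔ smallHeight d b U' j + y < d) := by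
    intro y
    have he := Finset.eq_of_segments
      (S := (Finset.range n).filter fun j => smallHeight d b U j + y < d)
      (S' := (Finset.range n).filter fun j => smallHeight d b U' j + y < d) (fun a b => b < a)
      (fun a b hab => by omega) ?_ ?_ ?_
    · simpa [hj] using Finset.ext_iff.mp he j
    · intro j1 h1 j2 h2 hlt
      simp only [Finset.mem_union, Finset.mem_filter, Finset.mem_range] at h1 h2 ⊢
      have hn : j2 < n := by omega
      have := h.smallHeight_antitone (b := b) hmu hlt hn
      omega
    · intro j1 h1 j2 h2 hlt
      simp only [Finset.mem_union, Finset.mem_filter, Finset.mem_range] at h1 h2 ⊢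
      have hn : j2 < n := by omega
      have := h'.smallHeight_antitone (b := b) hmu hlt hn
      omega
    · rw [← h.countAll_large hlam hmu, ← h'.countAll_large hlam hmu, hc]
  have h1 := hS (d - 1 - smallHeight d b U j)
  have h2 := hS (d - 1 - smallHeight d b U' j)
  have := hle U
  have := hle U'
  omega

theorem subset_of_rectangular (h : LRFilling lam mu U) (h' : LRFilling lam mu U')
    (hlam : ∀ k, lam.rowLen k = if k < b then a else 0)
    (hmu : ∀ i j, (i, j) ∈ mu.cells ↔ i < d ∧ j < n)
    (hc : ∀ x, countAll mu.cells U x = countAll mu.cells U' x) (c : ℕ × ℕ) : U c ⊆ U' c := by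
  obtain ⟨i, j⟩ := c
  intro x hx
  have hij := (hmu i j).mp (h.mem_of_mem _ _ hx)
  rcases lt_or_ge x b with hb | hb
  · obtain rfl := h.small_eq_row hlam i j x hx hb
    have hdown : ∀ V, LRFilling lam mu V → ∀ j1, x ∈ V (x, j1) → ∀ j2 < j1, x ∈ V (x, j2) := by
      intro V hV j1 h1 j2 hlt
      obtain ⟨y, hy⟩ := hV.nonempty (x, j2)
        (YoungDiagram.mem_cells_of_le (hV.mem_of_mem _ _ h1) le_rfl hlt.le)
      have h2 := hV.row x j2 j1 hlt y hy x h1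
      have h3 := hV.row_le_entry hy
      rwa [le_antisymm h2 h3] at hy
    have he := Finset.eq_of_segments
      (S := (Finset.range n).filter fun j => x ∈ U (x, j))
      (S' := (Finset.range n).filter fun j => x ∈ U' (x, j)) (fun a b => a < b)
      (fun a b hab => by omega) ?_ ?_ ?_
    · have := Finset.ext_iff.mp he j
      simp only [Finset.mem_filter, Finset.mem_range, hij.2, true_and] at this
      exact this.mp hx
    · intro j1 h1 j2 h2 hlt
      simp only [Finset.mem_filter, Finset.mem_range] at h1 ⊢
      exact ⟨by omega, hdown U h j1 h1.2 j2 hlt⟩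
    · intro j1 h1 j2 h2 hlt
      simp only [Finset.mem_filter, Finset.mem_range] at h1 ⊢
      exact ⟨by omega, hdown U' h' j1 h1.2 j2 hlt⟩
    · rw [← h.countAll_small hlam hmu hb, ← h'.countAll_small hlam hmu hb, hc]
  · obtain ⟨y, rfl⟩ := Nat.exists_eq_add_of_le hb
    have hs := h.large_add_smallHeight hlam hmu y i j hx
    rw [h.smallHeight_unique h' hlam hmu hc hij.2] at hs
    obtain ⟨z, hz⟩ := h'.exists_large (b := b) hmu hij.1 hij.2 (by omega)
    have := h'.large_add_smallHeight hlam hmu z i j hz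
    obtain rfl : z = y := by omega
    exact hz

end Rectangular

section SingleBox

/-- When `λ` has at most one box, an entry of row `i` is `i`, or it is `i + 1` in the last box of
the row and the same happens in all rows above. -/
theorem entry_of_card_le_one (h : LRFilling lam mu U) (h0 : lam.rowLen 0 ≤ 1)
    (h1 : ∀ k, lam.rowLen (k + 1) = 0) (i j : ℕ) : ∀ x ∈ U (i, j), x = i ∨
      (x = i + 1 ∧ j + 1 = mu.rowLen i ∧ ∀ i', i = i' + 1 → i ∈ U (i', mu.rowLen i' - 1)) := by
  induction i using Nat.strong_induction_on generalizing j with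
  | _ i ih =>
    have key : ∀ j' i' k j, i ≤ k → k + 1 ∈ U (i, j) → k ∈ U (i', j') → Precedes (i', j') (i, j) →
        k = i ∧ i = i' + 1 ∧ j' + 1 = mu.rowLen i' := by
      intro j' i' k j hik hx hk hp
      have hlt := h.above_of_precedes hx (by omega) hk hp
      have := ih i' hlt j' k hk
      omega
    have hup : ∀ j x, x ∈ U (i, j) → x = i ∨ (x = i + 1 ∧
        ∀ i', i = i' + 1 → i ∈ U (i', mu.rowLen i' - 1)) := by
      intro j x hx
      rcases (h.row_le_entry hx).eq_or_lt with e | hlt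
      · exact Or.inl e.symm
      right
      obtain ⟨k, rfl⟩ : ∃ k, x = k + 1 := ⟨x - 1, by omega⟩
      by_cases hk0 : k = 0
      · subst hk0
        exact ⟨by omega, fun i' hi' => by omega⟩
      · obtain ⟨⟨i', j'⟩, hp, hk⟩ := h.exists_precedes hx (by
          obtain ⟨l, rfl⟩ := Nat.exists_eq_succ_of_ne_zero hk0
          rw [h1 l]; exact Nat.zero_le _)
        obtain ⟨rfl, h3, h4⟩ := key j' i' k j (by omega) hx hk hp
        refine ⟨rfl, fun i2 hi2 => ?_⟩
        obtain rfl : i' = i2 := by omega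
        rwa [← h4, Nat.add_sub_cancel]
    intro x hx
    rcases hup j x hx with e | ⟨rfl, e⟩
    · exact Or.inl e
    refine Or.inr ⟨rfl, ?_, e⟩
    have hj := YoungDiagram.mem_cells_iff_lt_rowLen.mp (h.mem_of_mem _ _ hx)
    by_contra hne
    have hc : (i, j + 1) ∈ mu.cells := YoungDiagram.mem_cells_iff_lt_rowLen.mpr (by omega)
    obtain ⟨y, hy⟩ := h.nonempty _ hc
    have hy1 := h.row i j (j + 1) (by omega) _ hx y hy
    obtain rfl : y = i + 1 := by
      rcases hup _ _ hy with e | ⟨e, -⟩ <;> omega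
    have hpos : 0 < countBefore mu.cells U (i, j) (i + 1) := by
      refine Finset.card_pos.mpr ⟨(i, j + 1), Finset.mem_filter.mpr ⟨hc, Or.inl ?_, hy⟩⟩
      exact Nat.lt_succ_self j
    have hlat := h.lattice _ _ hx
    have hle : countBefore mu.cells U (i, j) i ≤ if i = 0 then 0 else 1 := by
      split_ifs with hi
      · rw [Nat.le_zero, countBefore, Finset.card_eq_zero, Finset.filter_eq_empty_iff]
        rintro ⟨i', j'⟩ _ ⟨hp, hk⟩
        have := key j' i' i j le_rfl hx hk hp
        omega
      · rw [countBefore, Finset.card_le_one]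
        rintro ⟨i1, j1⟩ hm1 ⟨i2, j2⟩ hm2
        rw [Finset.mem_filter] at hm1 hm2
        have e1 := key j1 i1 i j le_rfl hx hm1.2.2 hm1.2.1
        have e2 := key j2 i2 i j le_rfl hx hm2.2.2 hm2.2.1
        obtain rfl : i1 = i2 := by omega
        simp only [Prod.mk.injEq, true_and]
        omega
    rw [h1] at hlat
    split_ifs at hle with hi
    · subst hi; omega
    · obtain ⟨l, rfl⟩ := Nat.exists_eq_succ_of_ne_zero hi
      rw [Nat.succ_eq_add_one, h1 l] at hlat
      rw [Nat.succ_eq_add_one] at *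
      omega

theorem countAll_of_card_le_one (h : LRFilling lam mu U) (h0 : lam.rowLen 0 ≤ 1)
    (h1 : ∀ k, lam.rowLen (k + 1) = 0) (x : ℕ) : countAll mu.cells U x =
      (if 0 < x ∧ x ∈ U (x - 1, mu.rowLen (x - 1) - 1) then 1 else 0) + (mu.rowLen x - 1) +
        (if x ∈ U (x, mu.rowLen x - 1) then 1 else 0) := by
  have hrow : ((mu.cells.filter fun c => x ∈ U c).filter fun c => c.1 = x).card =
      (mu.rowLen x - 1) + (if x ∈ U (x, mu.rowLen x - 1) then 1 else 0) := by
    have himg : ((mu.cells.filter fun c => x ∈ U c).filter fun c => c.1 = x) =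
        (((Finset.range (mu.rowLen x - 1)) ∪
          (if x ∈ U (x, mu.rowLen x - 1) then {mu.rowLen x - 1} else ∅)).image fun j => (x, j)) := by
      ext ⟨i, j⟩
      simp only [Finset.mem_filter, Finset.mem_image, Finset.mem_union, Finset.mem_range,
        Prod.mk.injEq]
      constructor
      · rintro ⟨⟨hc, hx⟩, rfl⟩
        have hj := YoungDiagram.mem_cells_iff_lt_rowLen.mp hc
        refine ⟨j, ?_, rfl, rfl⟩
        by_cases hjl : j = mu.rowLen i - 1
        · right; rw [if_pos (hjl ▸ hx)]; simpa using hjl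
        · left; omega
      · rintro ⟨j', hj', rfl, rfl⟩
        rcases hj' with hj' | hj'
        · have hc : (x, j') ∈ mu.cells := YoungDiagram.mem_cells_iff_lt_rowLen.mpr (by omega)
          obtain ⟨y, hy⟩ := h.nonempty _ hc
          rcases h.entry_of_card_le_one h0 h1 x j' y hy with rfl | hh
          · exact ⟨⟨hc, hy⟩, rfl⟩
          · omega
        · split_ifs at hj' with hx
          · obtain rfl : j' = mu.rowLen x - 1 := by simpa using hj'
            exact ⟨⟨h.mem_of_mem _ _ hx, hx⟩, rfl⟩
          · simp at hj'
    rw [himg, Finset.card_image_of_injective _ (fun a b hab => by simpa using hab),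
      Finset.card_union_of_disjoint, Finset.card_range]
    · split_ifs <;> simp
    · split_ifs <;> simp
  have hprev : ((mu.cells.filter fun c => x ∈ U c).filter fun c => ¬ c.1 = x).card =
      if 0 < x ∧ x ∈ U (x - 1, mu.rowLen (x - 1) - 1) then 1 else 0 := by
    split_ifs with hy
    · obtain ⟨y, rfl⟩ : ∃ y, x = y + 1 := ⟨x - 1, by omega⟩
      replace hy := hy.2
      rw [Nat.add_sub_cancel] at hy
      rw [Finset.card_eq_one]
      refine ⟨(y, mu.rowLen y - 1), ?_⟩
      ext ⟨i, j⟩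
      simp only [Finset.mem_filter, Finset.mem_singleton, Prod.mk.injEq]
      constructor
      · rintro ⟨⟨hc, hx⟩, hne⟩
        rcases h.entry_of_card_le_one h0 h1 i j _ hx with hh | ⟨hh, hj, -⟩
        · exact absurd hh.symm hne
        · obtain rfl : y = i := by omega
          omega
      · rintro ⟨rfl, rfl⟩
        exact ⟨⟨h.mem_of_mem _ _ hy, hy⟩, by omega⟩
    · rw [Finset.card_eq_zero, Finset.filter_eq_empty_iff]
      rintro ⟨i, j⟩ hc hne
      rw [Finset.mem_filter] at hc
      rcases h.entry_of_card_le_one h0 h1 i j _ hc.2 with hh | ⟨hh, hj, -⟩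
      · exact hne hh.symm
      · subst hh
        exact hy ⟨by omega, by rw [Nat.add_sub_cancel, ← hj, Nat.add_sub_cancel]; exact hc.2⟩
  rw [countAll, ← Finset.card_filter_add_card_filter_not (fun c : ℕ × ℕ => c.1 = x), hrow, hprev]
  omega

theorem last_mem_or (h : LRFilling lam mu U) (h0 : lam.rowLen 0 ≤ 1)
    (h1 : ∀ k, lam.rowLen (k + 1) = 0) {x : ℕ} (hx : 0 < mu.rowLen x) :
    x ∈ U (x, mu.rowLen x - 1) ∨ x + 1 ∈ U (x, mu.rowLen x - 1) := by
  obtain ⟨y, hy⟩ := h.nonempty (x, mu.rowLen x - 1)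
    (YoungDiagram.mem_cells_iff_lt_rowLen.mpr (by omega))
  rcases h.entry_of_card_le_one h0 h1 _ _ y hy with rfl | ⟨rfl, -⟩
  · exact Or.inl hy
  · exact Or.inr hy

theorem rowLen_pos_of_last_mem (h : LRFilling lam mu U) {x y : ℕ}
    (hx : y ∈ U (x, mu.rowLen x - 1)) : 0 < mu.rowLen x := by
  have := YoungDiagram.mem_cells_iff_lt_rowLen.mp (h.mem_of_mem _ _ hx)
  omega

theorem shifted_of_shifted (h : LRFilling lam mu U) (h' : LRFilling lam mu U')
    (h0 : lam.rowLen 0 ≤ 1) (h1 : ∀ k, lam.rowLen (k + 1) = 0)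
    (hc : ∀ x, countAll mu.cells U x = countAll mu.cells U' x) {x : ℕ}
    (hx : x + 1 ∈ U (x, mu.rowLen x - 1)) : x + 1 ∈ U' (x, mu.rowLen x - 1) := by
  by_contra hx'
  have hstep : ∀ y, x ≤ y → y + 1 ∈ U (y, mu.rowLen y - 1) ∧ y + 1 ∉ U' (y, mu.rowLen y - 1) := by
    intro y hy
    induction y, hy using Nat.le_induction with
    | base => exact ⟨hx, hx'⟩
    | succ y hy ih =>
      have hn : y + 1 + 1 ∉ U' (y + 1, mu.rowLen (y + 1) - 1) := by
        intro hm
        rcases h'.entry_of_card_le_one h0 h1 _ _ _ hm with hh | ⟨-, -, hh⟩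
        · omega
        · exact ih.2 (hh y rfl)
      refine ⟨?_, hn⟩
      have hcount := hc (y + 1)
      rw [h.countAll_of_card_le_one h0 h1, h'.countAll_of_card_le_one h0 h1,
        if_pos ⟨by omega, by simpa using ih.1⟩,
        if_neg (c := _ ∧ _) (by rintro ⟨-, hz⟩; exact ih.2 (by simpa using hz))] at hcount
      by_cases hpos : 0 < mu.rowLen (y + 1)
      · have hg := (h'.last_mem_or h0 h1 hpos).resolve_right hn
        refine (h.last_mem_or h0 h1 hpos).resolve_left fun hg' => ?_
        rw [if_pos hg, if_pos hg'] at hcount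
        omega
      · rw [if_neg (c := _ ∈ U' _) fun hm => hpos (h'.rowLen_pos_of_last_mem hm)] at hcount
        omega
  have hfin : mu.rowLen (x + mu.colLen 0) = 0 := by
    by_contra hne
    have := YoungDiagram.mem_iff_lt_colLen.mp
      (YoungDiagram.mem_iff_lt_rowLen.mpr (Nat.pos_of_ne_zero hne))
    omega
  have := h.rowLen_pos_of_last_mem (hstep (x + mu.colLen 0) (Nat.le_add_right _ _)).1
  omega

theorem subset_of_card_le_one (h : LRFilling lam mu U) (h' : LRFilling lam mu U')
    (h0 : lam.rowLen 0 ≤ 1) (h1 : ∀ k, lam.rowLen (k + 1) = 0)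
    (hc : ∀ x, countAll mu.cells U x = countAll mu.cells U' x) (c : ℕ × ℕ) : U c ⊆ U' c := by
  obtain ⟨i, j⟩ := c
  have hF : ∀ x, x + 1 ∈ U (x, mu.rowLen x - 1) ↔ x + 1 ∈ U' (x, mu.rowLen x - 1) := fun x =>
    ⟨h.shifted_of_shifted h' h0 h1 hc, h'.shifted_of_shifted h h0 h1 fun x => (hc x).symm⟩
  intro x hx
  have hij := h.mem_of_mem _ _ hx
  have hj := YoungDiagram.mem_cells_iff_lt_rowLen.mp hij
  rcases h.entry_of_card_le_one h0 h1 i j x hx with rfl | ⟨rfl, hl, -⟩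
  · by_cases hjl : j = mu.rowLen x - 1
    · subst hjl
      have hcount := hc x
      rw [h.countAll_of_card_le_one h0 h1, h'.countAll_of_card_le_one h0 h1, if_pos hx] at hcount
      have hiff : (0 < x ∧ x ∈ U (x - 1, mu.rowLen (x - 1) - 1)) ↔
          (0 < x ∧ x ∈ U' (x - 1, mu.rowLen (x - 1) - 1)) := by
        refine and_congr_right fun hx0 => ?_
        have := hF (x - 1)
        rwa [Nat.sub_add_cancel hx0] at this
      simp only [hiff] at hcount
      by_contra hx'
      rw [if_neg (c := _ ∈ U' _) hx'] at hcount
      omega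
    · obtain ⟨y, hy⟩ := h'.nonempty _ hij
      rcases h'.entry_of_card_le_one h0 h1 x j y hy with rfl | hh
      · exact hy
      · omega
  · obtain rfl : j = mu.rowLen i - 1 := by omega
    exact (hF i).mp hx

end SingleBox

theorem countAll_of_mu_card_le_one (hmu : mu.card ≤ 1) {c : ℕ × ℕ}
    (hc : c ∈ mu.cells) (x : ℕ) : countAll mu.cells U x = if x ∈ U c then 1 else 0 := by
  have : mu.cells = {c} := Finset.eq_singleton_iff_unique_mem.mpr
    ⟨hc, fun c' hc' => Finset.card_le_one.mp hmu _ hc' _ hc⟩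
  rw [countAll, this, Finset.filter_singleton]
  split_ifs <;> simp

theorem subset_of_mu_card_le_one (h : LRFilling lam mu U) (hmu : mu.card ≤ 1)
    (hc : ∀ x, countAll mu.cells U x = countAll mu.cells U' x) (c : ℕ × ℕ) : U c ⊆ U' c := by
  intro x hx
  have hm := h.mem_of_mem _ _ hx
  have := hc x
  rw [countAll_of_mu_card_le_one hmu hm, countAll_of_mu_card_le_one hmu hm, if_pos hx] at this
  by_contra hx'
  simp [hx'] at this

end LRFilling

theorem IsRectangular.exists_mem_iff {mu : YoungDiagram} (h : IsRectangular mu) :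
    ∃ d n, ∀ i j, (i, j) ∈ mu.cells ↔ i < d ∧ j < n := by
  obtain ⟨n, d, h⟩ := h
  exact ⟨d, n, fun i j => by rw [h]; simp⟩

theorem rowLen_of_mem_iff {mu : YoungDiagram} {d n : ℕ}
    (h : ∀ i j, (i, j) ∈ mu.cells ↔ i < d ∧ j < n) (k : ℕ) :
    mu.rowLen k = if k < d then n else 0 := by
  have h1 := h k (mu.rowLen k)
  have h2 := h k n
  have h3 := h k 0
  rw [YoungDiagram.mem_cells_iff_lt_rowLen] at h1 h2 h3
  split_ifs with hk <;> omega

theorem rowLen_of_card_le_one {lam : YoungDiagram} (h : lam.card ≤ 1) :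
    lam.rowLen 0 ≤ 1 ∧ ∀ k, lam.rowLen (k + 1) = 0 := by
  have key := Finset.card_le_one.mp h
  have h00 : ∀ i j, (i, j) ∈ lam.cells → (i, j) = (0, 0) := fun i j hij =>
    key _ hij _ (YoungDiagram.mem_cells_of_le hij (Nat.zero_le _) (Nat.zero_le _))
  constructor
  · by_contra! hlt
    have := h00 0 1 (YoungDiagram.mem_cells_iff_lt_rowLen.mpr hlt)
    simp at this
  · intro k
    by_contra hne
    have := h00 (k + 1) 0 (YoungDiagram.mem_cells_iff_lt_rowLen.mpr (Nat.pos_of_ne_zero hne))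
    simp at this

theorem LRFilling.unique {lam mu : YoungDiagram} {U U' : ℕ × ℕ → Finset ℕ}
    (H : (IsRectangular lam ∧ IsRectangular mu) ∨ lam.card ≤ 1 ∨ mu.card ≤ 1)
    (h : LRFilling lam mu U) (h' : LRFilling lam mu U')
    (hc : ∀ x, countAll mu.cells U x = countAll mu.cells U' x) : U = U' := by
  have hc' : ∀ x, countAll mu.cells U' x = countAll mu.cells U x := fun x => (hc x).symm
  funext c
  rcases H with ⟨hl, hm⟩ | hl | hm
  · obtain ⟨b, a, hl⟩ := hl.exists_mem_iff
    obtain ⟨d, n, hm⟩ := hm.exists_mem_iff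
    have hl := rowLen_of_mem_iff hl
    exact (h.subset_of_rectangular h' hl hm hc c).antisymm (h'.subset_of_rectangular h hl hm hc' c)
  · obtain ⟨h0, h1⟩ := rowLen_of_card_le_one hl
    exact (h.subset_of_card_le_one h' h0 h1 hc c).antisymm (h'.subset_of_card_le_one h h0 h1 hc' c)
  · exact (h.subset_of_mu_card_le_one hm hc c).antisymm (h'.subset_of_mu_card_le_one hm hc' c)

namespace LRFilling

variable {lam mu mu0 : YoungDiagram} {U U' : ℕ × ℕ → Finset ℕ} {κ : ℕ → ℕ}

theorem rowLen_add_countAll_le (h : LRFilling lam mu U) (k : ℕ) :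
    lam.rowLen (k + 1) + countAll mu.cells U (k + 1) ≤ lam.rowLen k + countAll mu.cells U k := by
  have hanti := lam.rowLen_anti k (k + 1) k.le_succ
  rcases (mu.cells.filter fun c => k + 1 ∈ U c).eq_empty_or_nonempty with he | hne
  · rw [countAll, he, Finset.card_empty]
    omega
  · obtain ⟨c, hc, hmin⟩ := Finset.exists_min_image _ (fun c : ℕ × ℕ => c.2) hne
    rw [Finset.mem_filter] at hc
    have hlat := h.lattice c k hc.2
    have h1 : countAll mu.cells U (k + 1) ≤ countBefore mu.cells U c (k + 1) + 1 := by
      refine (Finset.card_le_card fun c' hc' => ?_).trans (Finset.card_insert_le c _)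
      have hle := hmin c' hc'
      rw [Finset.mem_filter] at hc'
      rw [Finset.mem_insert, Finset.mem_filter]
      by_cases heq : c' = c
      · exact Or.inl heq
      refine Or.inr ⟨hc'.1, Or.inl ?_, hc'.2⟩
      obtain ⟨i, j⟩ := c
      obtain ⟨i', j'⟩ := c'
      rcases Nat.lt_or_eq_of_le hle with hlt | rfl
      · exact hlt
      · rcases lt_trichotomy i i' with hi | rfl | hi
        · exact absurd (h.col _ _ _ hi _ hc.2 _ hc'.2) (lt_irrefl _)
        · exact absurd rfl heq
        · exact absurd (h.col _ _ _ hi _ hc'.2 _ hc.2) (lt_irrefl _)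
    have h2 : countBefore mu.cells U c k ≤ countAll mu.cells U k :=
      Finset.card_le_card fun c' hc' => by
        rw [Finset.mem_filter] at hc' ⊢
        exact ⟨hc'.1, hc'.2.2⟩
    omega

theorem lt_of_lt_of_le (h : LRFilling lam mu U) {i i' j j' a b : ℕ} (hi : i < i') (hj : j ≤ j')
    (ha : a ∈ U (i, j)) (hb : b ∈ U (i', j')) : a < b := by
  rcases Nat.lt_or_eq_of_le hj with hj | rfl
  · obtain ⟨y, hy⟩ := h.nonempty _
      (YoungDiagram.mem_cells_of_le (h.mem_of_mem _ _ hb) le_rfl hj.le)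
    exact (h.col _ _ _ hi _ ha _ hy).trans_le (h.row _ _ _ hj _ hy _ hb)
  · exact h.col _ _ _ hi _ ha _ hb

end LRFilling

/-- Insert `κ i` boxes with the single entry `i` at the beginning of each row `i`. -/
def extendLeft (κ : ℕ → ℕ) (U : ℕ × ℕ → Finset ℕ) (c : ℕ × ℕ) : Finset ℕ :=
  if c.2 < κ c.1 then {c.1} else U (c.1, c.2 - κ c.1)

section ExtendLeft

variable {lam mu mu0 : YoungDiagram} {U U' : ℕ × ℕ → Finset ℕ} {κ : ℕ → ℕ}

theorem extendLeft_add (i j : ℕ) : extendLeft κ U (i, j + κ i) = U (i, j) := by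
  simp [extendLeft]

theorem extendLeft_injective : Function.Injective (extendLeft κ) := fun U U' hU => by
  funext ⟨i, j⟩
  rw [← extendLeft_add (κ := κ) (U := U), hU, extendLeft_add]

theorem mem_extendLeft {i j x : ℕ} : x ∈ extendLeft κ U (i, j) ↔
    (j < κ i ∧ x = i) ∨ (κ i ≤ j ∧ x ∈ U (i, j - κ i)) := by
  by_cases hj : j < κ i
  · simp [extendLeft, hj]
  · simp [extendLeft, hj, not_lt.mp hj]

theorem card_filter_extendLeft (hmu : ∀ i, mu.rowLen i = κ i + mu0.rowLen i)
    (p : ℕ × ℕ → Prop) [DecidablePred p] (x : ℕ) :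
    (mu.cells.filter fun c => p c ∧ x ∈ extendLeft κ U c).card =
      ((Finset.range (κ x)).filter fun j => p (x, j)).card +
        (mu0.cells.filter fun c => p (c.1, c.2 + κ c.1) ∧ x ∈ U c).card := by
  have himg : (mu.cells.filter fun c => p c ∧ x ∈ extendLeft κ U c) =
      (((Finset.range (κ x)).filter fun j => p (x, j)).image fun j => (x, j)) ∪
        ((mu0.cells.filter fun c => p (c.1, c.2 + κ c.1) ∧ x ∈ U c).image
          fun c => (c.1, c.2 + κ c.1)) := by
    ext ⟨i, j⟩
    simp only [Finset.mem_filter, Finset.mem_union, Finset.mem_image, Finset.mem_range,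
      YoungDiagram.mem_cells_iff_lt_rowLen, hmu, mem_extendLeft, Prod.exists, Prod.mk.injEq]
    constructor
    · rintro ⟨hc, hp, ⟨hj, rfl⟩ | ⟨hj, hx⟩⟩
      · exact Or.inl ⟨j, ⟨hj, hp⟩, rfl, rfl⟩
      · exact Or.inr ⟨i, j - κ i, ⟨by omega, by rwa [Nat.sub_add_cancel hj], hx⟩, rfl, by omega⟩
    · rintro (⟨j, ⟨hj, hp⟩, rfl, rfl⟩ | ⟨i, j, ⟨hj, hp, hx⟩, rfl, rfl⟩)
      · exact ⟨by omega, hp, Or.inl ⟨hj, rfl⟩⟩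
      · exact ⟨by omega, hp, Or.inr ⟨by omega, by simpa using hx⟩⟩
  rw [himg, Finset.card_union_of_disjoint, Finset.card_image_of_injective,
    Finset.card_image_of_injective]
  · rintro ⟨i, j⟩ ⟨i', j'⟩ hij
    simp only [Prod.mk.injEq] at hij ⊢
    obtain ⟨rfl, hij⟩ := hij
    omega
  · exact fun a b hab => by simpa using hab
  · rw [Finset.disjoint_left]
    rintro ⟨i, j⟩ h1 h2
    simp only [Finset.mem_filter, Finset.mem_image, Finset.mem_range, Prod.exists,
      Prod.mk.injEq] at h1 h2
    obtain ⟨j1, ⟨h1, -⟩, rfl, rfl⟩ := h1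
    obtain ⟨i2, j2, -, rfl, h2⟩ := h2
    omega

theorem countAll_extendLeft (hmu : ∀ i, mu.rowLen i = κ i + mu0.rowLen i) (x : ℕ) :
    countAll mu.cells (extendLeft κ U) x = κ x + countAll mu0.cells U x := by
  simpa [countAll] using card_filter_extendLeft (U := U) hmu (fun _ => True) x

theorem LRFilling.extendLeft (h : LRFilling lam mu0 U) (hκ : Antitone κ)
    (hmu : ∀ i, mu.rowLen i = κ i + mu0.rowLen i) : LRFilling lam mu (extendLeft κ U) where
  nonempty := by
    rintro ⟨i, j⟩ hc
    rw [YoungDiagram.mem_cells_iff_lt_rowLen, hmu] at hc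
    rcases lt_or_ge j (κ i) with hj | hj
    · exact ⟨i, mem_extendLeft.mpr (Or.inl ⟨hj, rfl⟩)⟩
    · obtain ⟨y, hy⟩ := h.nonempty (i, j - κ i)
        (YoungDiagram.mem_cells_iff_lt_rowLen.mpr (by omega))
      exact ⟨y, mem_extendLeft.mpr (Or.inr ⟨hj, hy⟩)⟩
  mem_of_mem := by
    rintro ⟨i, j⟩ x hx
    rw [YoungDiagram.mem_cells_iff_lt_rowLen, hmu]
    rcases mem_extendLeft.mp hx with ⟨hj, -⟩ | ⟨hj, hx⟩
    · omega
    · have := YoungDiagram.mem_cells_iff_lt_rowLen.mp (h.mem_of_mem _ _ hx)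
      omega
  row := by
    intro i j j' hj a ha b hb
    rcases mem_extendLeft.mp ha with ⟨ha', rfl⟩ | ⟨ha', ha⟩ <;>
      rcases mem_extendLeft.mp hb with ⟨hb', rfl⟩ | ⟨hb', hb⟩
    · exact le_rfl
    · exact h.row_le_entry hb
    · omega
    · exact h.row _ _ _ (by omega) _ ha _ hb
  col := by
    intro i i' j hi a ha b hb
    have := hκ hi.le
    rcases mem_extendLeft.mp ha with ⟨ha', rfl⟩ | ⟨ha', ha⟩ <;>
      rcases mem_extendLeft.mp hb with ⟨hb', rfl⟩ | ⟨hb', hb⟩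
    · exact hi
    · exact hi.trans_le (h.row_le_entry hb)
    · omega
    · exact h.lt_of_lt_of_le hi (by omega) ha hb
  lattice := by
    rintro ⟨i, j⟩ k hk
    have hκk : κ (k + 1) ≤ κ k := hκ k.le_succ
    rw [countBefore, countBefore, card_filter_extendLeft hmu, card_filter_extendLeft hmu]
    rcases mem_extendLeft.mp hk with ⟨hj, rfl⟩ | ⟨hj, hk⟩
    · have htot := h.rowLen_add_countAll_le k
      have h1 : (mu0.cells.filter fun c => Precedes (c.1, c.2 + κ c.1) (k + 1, j) ∧
          k + 1 ∈ U c).card ≤ countAll mu0.cells U (k + 1) :=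
        Finset.card_le_card fun c' hc' => by
          rw [Finset.mem_filter] at hc' ⊢
          exact ⟨hc'.1, hc'.2.2⟩
      have h2 : countAll mu0.cells U k ≤ (mu0.cells.filter fun c =>
          Precedes (c.1, c.2 + κ c.1) (k + 1, j) ∧ k ∈ U c).card :=
        Finset.card_le_card fun c' hc' => by
          rw [Finset.mem_filter] at hc' ⊢
          have hle := h.row_le_entry (i := c'.1) (j := c'.2) hc'.2
          have : κ (k + 1) ≤ κ c'.1 := hκ (hle.trans k.le_succ)
          exact ⟨hc'.1, Or.inl (by simp only; omega), hc'.2⟩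
      have h3 : ((Finset.range (κ (k + 1))).filter fun j' =>
            Precedes (k + 1, j') (k + 1, j)).card + 1 ≤
          ((Finset.range (κ k)).filter fun j' => Precedes (k, j') (k + 1, j)).card := by
        rw [← Finset.card_insert_of_notMem (a := j) (by simp [Precedes])]
        refine Finset.card_le_card fun j' hj' => ?_
        rw [Finset.mem_insert, Finset.mem_filter, Finset.mem_range] at hj'
        rw [Finset.mem_filter, Finset.mem_range]
        simp only [Precedes] at hj' ⊢
        omega
      omega
    · have hlat := h.lattice _ _ hk
      have hik := h.row_le_entry hk
      have h1 : (mu0.cells.filter fun c => Precedes (c.1, c.2 + κ c.1) (i, j) ∧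
          k + 1 ∈ U c).card ≤ countBefore mu0.cells U (i, j - κ i) (k + 1) := by
        refine Finset.card_le_card ?_
        rintro ⟨i', j'⟩ hc'
        rw [Finset.mem_filter] at hc' ⊢
        refine ⟨hc'.1, ?_, hc'.2.2⟩
        have hp := hc'.2.1
        simp only [Precedes] at hp ⊢
        rcases lt_or_ge i' i with hi | hi
        · by_contra hcon
          exact absurd (h.lt_of_lt_of_le hi (by omega) hc'.2.2 hk) (lt_irrefl _)
        · have := hκ hi
          omega
      have h2 : countBefore mu0.cells U (i, j - κ i) k ≤ (mu0.cells.filter fun c =>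
          Precedes (c.1, c.2 + κ c.1) (i, j) ∧ k ∈ U c).card := by
        refine Finset.card_le_card ?_
        rintro ⟨i', j'⟩ hc'
        rw [Finset.mem_filter] at hc' ⊢
        refine ⟨hc'.1, ?_, hc'.2.2⟩
        have hp := hc'.2.1
        simp only [Precedes] at hp ⊢
        rcases le_or_gt i' i with hi | hi
        · have := hκ hi
          omega
        · have := h.lt_of_lt_of_le hi (by omega) hk hc'.2.2
          omega
      have h3 : ((Finset.range (κ (k + 1))).filter fun j' => Precedes (k + 1, j') (i, j)).card ≤
          ((Finset.range (κ k)).filter fun j' => Precedes (k, j') (i, j)).card := by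
        refine Finset.card_le_card fun j' hj' => ?_
        rw [Finset.mem_filter, Finset.mem_range] at hj' ⊢
        simp only [Precedes] at hj' ⊢
        omega
      omega

end ExtendLeft

/-- A set-valued column of height `d` with set of entries `S`, the `i`-th box from the top
containing `A i`. -/
structure IsColumn (d : ℕ) (A : ℕ → Finset ℕ) (S : Finset ℕ) : Prop where
  nonempty : ∀ i < d, (A i).Nonempty
  lt_of_mem : ∀ i, ∀ x ∈ A i, i < d
  strict : ∀ i i', i < i' → ∀ a ∈ A i, ∀ b ∈ A i', a < b
  mem_iff : ∀ x, x ∈ S ↔ ∃ i, x ∈ A i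

/-- The two-column filling with columns `A` and `B`. -/
def twoColumns (A B : ℕ → Finset ℕ) (c : ℕ × ℕ) : Finset ℕ :=
  if c.2 = 0 then A c.1 else if c.2 = 1 then B c.1 else ∅

namespace IsColumn

variable {d : ℕ} {A : ℕ → Finset ℕ} {S : Finset ℕ}

theorem eq_of_mem (h : IsColumn d A S) {x i i' : ℕ} (hi : x ∈ A i) (hi' : x ∈ A i') : i = i' := by
  rcases lt_trichotomy i i' with hlt | heq | hlt
  · exact absurd (h.strict _ _ hlt _ hi _ hi') (lt_irrefl _)
  · exact heq
  · exact absurd (h.strict _ _ hlt _ hi' _ hi) (lt_irrefl _)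

theorem card_filter_of_forall (h : IsColumn d A S) {p : ℕ → Prop} [DecidablePred p] {x : ℕ}
    (hp : ∀ i, x ∈ A i → p i) :
    ((Finset.range d).filter fun i => p i ∧ x ∈ A i).card = if x ∈ S then 1 else 0 := by
  split_ifs with hx
  · obtain ⟨i, hi⟩ := (h.mem_iff x).mp hx
    rw [Finset.card_eq_one]
    refine ⟨i, ?_⟩
    ext i'
    rw [Finset.mem_filter, Finset.mem_range, Finset.mem_singleton]
    constructor
    · exact fun hi' => h.eq_of_mem hi'.2.2 hi
    · rintro rfl
      exact ⟨h.lt_of_mem _ _ hi, hp _ hi, hi⟩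
  · rw [Finset.card_eq_zero, Finset.filter_eq_empty_iff]
    exact fun i _ hi => hx ((h.mem_iff x).mpr ⟨i, hi.2⟩)

theorem card_filter_of_forall_not {p : ℕ → Prop} [DecidablePred p] {x : ℕ}
    (hp : ∀ i, x ∈ A i → ¬ p i) :
    ((Finset.range d).filter fun i => p i ∧ x ∈ A i).card = 0 := by
  rw [Finset.card_eq_zero, Finset.filter_eq_empty_iff]
  exact fun i _ hi => hp i hi.2 hi.1

end IsColumn

section TwoColumns

variable {lam mu : YoungDiagram} {d e : ℕ} {A B : ℕ → Finset ℕ} {SA SB : Finset ℕ}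

theorem mem_twoColumns {i j x : ℕ} :
    x ∈ twoColumns A B (i, j) ↔ (j = 0 ∧ x ∈ A i) ∨ (j = 1 ∧ x ∈ B i) := by
  simp only [twoColumns]
  split_ifs <;> simp [*]

theorem twoColumns_injective {A' B' : ℕ → Finset ℕ} (h : twoColumns A B = twoColumns A' B') :
    A = A' ∧ B = B' := by
  constructor
  · funext i
    simpa [twoColumns] using congrFun h (i, 0)
  · funext i
    simpa [twoColumns] using congrFun h (i, 1)

theorem card_filter_twoColumns (hA : IsColumn d A SA) (hB : IsColumn e B SB)
    (hmu : ∀ i, mu.rowLen i = (if i < d then 1 else 0) + (if i < e then 1 else 0)) (hed : e ≤ d)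
    (p : ℕ × ℕ → Prop) [DecidablePred p] (x : ℕ) :
    (mu.cells.filter fun c => p c ∧ x ∈ twoColumns A B c).card =
      ((Finset.range d).filter fun i => p (i, 0) ∧ x ∈ A i).card +
        ((Finset.range e).filter fun i => p (i, 1) ∧ x ∈ B i).card := by
  have himg : (mu.cells.filter fun c => p c ∧ x ∈ twoColumns A B c) =
      (((Finset.range d).filter fun i => p (i, 0) ∧ x ∈ A i).image fun i => (i, 0)) ∪
        (((Finset.range e).filter fun i => p (i, 1) ∧ x ∈ B i).image fun i => (i, 1)) := by
    ext ⟨i, j⟩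
    simp only [Finset.mem_filter, Finset.mem_union, Finset.mem_image, Finset.mem_range,
      YoungDiagram.mem_cells_iff_lt_rowLen, mem_twoColumns, Prod.mk.injEq]
    constructor
    · rintro ⟨-, hp, ⟨rfl, hx⟩ | ⟨rfl, hx⟩⟩
      · exact Or.inl ⟨i, ⟨hA.lt_of_mem _ _ hx, hp, hx⟩, rfl, rfl⟩
      · exact Or.inr ⟨i, ⟨hB.lt_of_mem _ _ hx, hp, hx⟩, rfl, rfl⟩
    · rintro (⟨i, ⟨hi, hp, hx⟩, rfl, rfl⟩ | ⟨i, ⟨hi, hp, hx⟩, rfl, rfl⟩)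
      · exact ⟨by rw [hmu, if_pos hi]; omega, hp, Or.inl ⟨rfl, hx⟩⟩
      · exact ⟨by rw [hmu, if_pos hi, if_pos (hi.trans_le hed)]; omega, hp, Or.inr ⟨rfl, hx⟩⟩
  rw [himg, Finset.card_union_of_disjoint, Finset.card_image_of_injective,
    Finset.card_image_of_injective]
  · exact fun a b hab => by simpa using hab
  · exact fun a b hab => by simpa using hab
  · rw [Finset.disjoint_left]
    intro c h1 h2
    obtain ⟨i, -, rfl⟩ := Finset.mem_image.mp h1
    obtain ⟨i', -, hi'⟩ := Finset.mem_image.mp h2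
    simp at hi'

theorem countAll_twoColumns (hA : IsColumn d A SA) (hB : IsColumn e B SB)
    (hmu : ∀ i, mu.rowLen i = (if i < d then 1 else 0) + (if i < e then 1 else 0)) (hed : e ≤ d)
    (x : ℕ) : countAll mu.cells (twoColumns A B) x =
      (if x ∈ SA then 1 else 0) + (if x ∈ SB then 1 else 0) := by
  have := card_filter_twoColumns hA hB hmu hed (fun _ => True) x
  rw [hA.card_filter_of_forall fun _ _ => trivial, hB.card_filter_of_forall fun _ _ => trivial]
    at this
  simpa [countAll] using this

theorem LRFilling.twoColumns (hA : IsColumn d A SA) (hB : IsColumn e B SB)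
    (hmu : ∀ i, mu.rowLen i = (if i < d then 1 else 0) + (if i < e then 1 else 0)) (hed : e ≤ d)
    (hrow : ∀ i, ∀ a ∈ A i, ∀ b ∈ B i, a ≤ b)
    (hlatB : ∀ i k, k + 1 ∈ B i →
      lam.rowLen (k + 1) + 1 ≤ lam.rowLen k + (if k ∈ SB ∧ k ∉ B i then 1 else 0))
    (hlatA : ∀ i k, k + 1 ∈ A i →
      lam.rowLen (k + 1) + (if k + 1 ∈ SB then 1 else 0) + 1 ≤
        lam.rowLen k + (if k ∈ SB then 1 else 0) + (if k ∈ SA ∧ k ∉ A i then 1 else 0)) :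
    LRFilling lam mu (twoColumns A B) where
  nonempty := by
    rintro ⟨i, j⟩ hc
    rw [YoungDiagram.mem_cells_iff_lt_rowLen, hmu] at hc
    have : (j = 0 ∧ i < d) ∨ (j = 1 ∧ i < e) := by
      split_ifs at hc <;> omega
    rcases this with ⟨rfl, hi⟩ | ⟨rfl, hi⟩
    · exact hA.nonempty i hi
    · exact hB.nonempty i hi
  mem_of_mem := by
    rintro ⟨i, j⟩ x hx
    rw [YoungDiagram.mem_cells_iff_lt_rowLen, hmu]
    rcases mem_twoColumns.mp hx with ⟨rfl, hx⟩ | ⟨rfl, hx⟩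
    · rw [if_pos (hA.lt_of_mem _ _ hx)]
      omega
    · have hi := hB.lt_of_mem _ _ hx
      rw [if_pos hi, if_pos (hi.trans_le hed)]
      omega
  row := by
    intro i j j' hj a ha b hb
    rcases mem_twoColumns.mp ha with ⟨rfl, ha⟩ | ⟨rfl, ha⟩ <;>
      rcases mem_twoColumns.mp hb with ⟨rfl, hb⟩ | ⟨rfl, hb⟩
    · omega
    · exact hrow i a ha b hb
    · omega
    · omega
  col := by
    intro i i' j hi a ha b hb
    rcases mem_twoColumns.mp ha with ⟨rfl, ha⟩ | ⟨rfl, ha⟩ <;>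
      rcases mem_twoColumns.mp hb with ⟨hj, hb⟩ | ⟨hj, hb⟩
    · exact hA.strict _ _ hi _ ha _ hb
    · omega
    · omega
    · exact hB.strict _ _ hi _ ha _ hb
  lattice := by
    rintro ⟨i, j⟩ k hk
    rw [countBefore, countBefore, card_filter_twoColumns hA hB hmu hed,
      card_filter_twoColumns hA hB hmu hed]
    have key : ∀ {d' : ℕ} {C : ℕ → Finset ℕ} {S : Finset ℕ}, IsColumn d' C S → ∀ j',
        k + 1 ∈ C i →
        ((Finset.range d').filter fun i' => Precedes (i', j') (i, j') ∧ k + 1 ∈ C i').card = 0 ∧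
        ((Finset.range d').filter fun i' => Precedes (i', j') (i, j') ∧ k ∈ C i').card =
          if k ∈ S ∧ k ∉ C i then 1 else 0 := by
      intro d' C S hC j' hk
      refine ⟨IsColumn.card_filter_of_forall_not fun i' hi' => ?_, ?_⟩
      · obtain rfl := hC.eq_of_mem hk hi'
        simp [Precedes]
      · by_cases hki : k ∈ C i
        · rw [if_neg (by simp [hki])]
          refine IsColumn.card_filter_of_forall_not fun i' hi' => ?_
          obtain rfl := hC.eq_of_mem hki hi'
          simp [Precedes]
        · rw [hC.card_filter_of_forall fun i' hi' => ?_]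
          · simp [hki]
          · refine Or.inr ⟨rfl, ?_⟩
            rcases lt_trichotomy i' i with hlt | rfl | hlt
            · exact hlt
            · exact absurd hi' hki
            · have := hC.strict _ _ hlt _ hk _ hi'
              omega
    rcases mem_twoColumns.mp hk with ⟨rfl, hk⟩ | ⟨rfl, hk⟩
    · have hB' : ∀ x, ((Finset.range e).filter fun i' =>
          Precedes (i', 1) (i, 0) ∧ x ∈ B i').card = if x ∈ SB then 1 else 0 := fun x =>
        hB.card_filter_of_forall fun _ _ => Or.inl (by simp)
      obtain ⟨h1, h2⟩ := key hA 0 hk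
      have := hlatA i k hk
      rw [h1, h2, hB', hB']
      omega
    · have hA' : ∀ x, ((Finset.range d).filter fun i' =>
          Precedes (i', 0) (i, 1) ∧ x ∈ A i').card = 0 := fun x =>
        IsColumn.card_filter_of_forall_not fun _ _ => by simp [Precedes]
      obtain ⟨h1, h2⟩ := key hB 1 hk
      have := hlatB i k hk
      rw [h1, h2, hA', hA']
      omega

end TwoColumns

/-- Two adjacent columns of heights `d` and `e`, with sets of entries `S` and `S'`, the entry `x`
being in row `r x` of the left and row `r' x` of the right column, that form a filling
appendable to `λ`. -/
structure IsLRPair (lam : YoungDiagram) (d e : ℕ) (S S' : Finset ℕ) (r r' : ℕ → ℕ) : Prop where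
  lt_left : ∀ x ∈ S, r x < d
  lt_right : ∀ x ∈ S', r' x < e
  mono_left : ∀ x ∈ S, ∀ y ∈ S, x ≤ y → r x ≤ r y
  mono_right : ∀ x ∈ S', ∀ y ∈ S', x ≤ y → r' x ≤ r' y
  surj_left : ∀ i < d, ∃ x ∈ S, r x = i
  surj_right : ∀ i < e, ∃ x ∈ S', r' x = i
  row : ∀ x ∈ S, ∀ y ∈ S', r x = r' y → x ≤ y
  lattice_right : ∀ k, k + 1 ∈ S' →
    lam.rowLen (k + 1) + 1 ≤ lam.rowLen k + (if k ∈ S' ∧ r' k ≠ r' (k + 1) then 1 else 0)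
  lattice_left : ∀ k, k + 1 ∈ S →
    lam.rowLen (k + 1) + (if k + 1 ∈ S' then 1 else 0) + 1 ≤
      lam.rowLen k + (if k ∈ S' then 1 else 0) + (if k ∈ S ∧ r k ≠ r (k + 1) then 1 else 0)

theorem isColumn_filter {d : ℕ} {S : Finset ℕ} {r : ℕ → ℕ} (hlt : ∀ x ∈ S, r x < d)
    (hmono : ∀ x ∈ S, ∀ y ∈ S, x ≤ y → r x ≤ r y) (hsurj : ∀ i < d, ∃ x ∈ S, r x = i) :
    IsColumn d (fun i => S.filter fun x => r x = i) S where
  nonempty i hi := by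
    obtain ⟨x, hx⟩ := hsurj i hi
    exact ⟨x, Finset.mem_filter.mpr hx⟩
  lt_of_mem i x hx := by
    obtain ⟨hxS, rfl⟩ := Finset.mem_filter.mp hx
    exact hlt x hxS
  strict i i' hi a ha b hb := by
    obtain ⟨haS, rfl⟩ := Finset.mem_filter.mp ha
    obtain ⟨hbS, rfl⟩ := Finset.mem_filter.mp hb
    by_contra! hba
    exact absurd (hmono b hbS a haS hba) (not_le.mpr hi)
  mem_iff x := by simp

section IsLRPair

variable {lam mu : YoungDiagram} {d e : ℕ} {S S' T T' : Finset ℕ} {r r' t t' : ℕ → ℕ}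

theorem IsLRPair.isColumn_left (h : IsLRPair lam d e S S' r r') :
    IsColumn d (fun i => S.filter fun x => r x = i) S :=
  isColumn_filter h.lt_left h.mono_left h.surj_left

theorem IsLRPair.isColumn_right (h : IsLRPair lam d e S S' r r') :
    IsColumn e (fun i => S'.filter fun x => r' x = i) S' :=
  isColumn_filter h.lt_right h.mono_right h.surj_right

theorem IsLRPair.lrFilling (h : IsLRPair lam d e S S' r r')
    (hmu : ∀ i, mu.rowLen i = (if i < d then 1 else 0) + (if i < e then 1 else 0)) (hed : e ≤ d) :
    LRFilling lam mu (twoColumns (fun i => S.filter fun x => r x = i)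
      (fun i => S'.filter fun x => r' x = i)) := by
  refine LRFilling.twoColumns h.isColumn_left h.isColumn_right hmu hed ?_ ?_ ?_
  · intro i a ha b hb
    rw [Finset.mem_filter] at ha hb
    exact h.row a ha.1 b hb.1 (ha.2.trans hb.2.symm)
  · intro i k hk
    obtain ⟨hkS, rfl⟩ := Finset.mem_filter.mp hk
    refine (h.lattice_right k hkS).trans (Nat.add_le_add_left ?_ _)
    split_ifs with h1 h2 <;> simp_all
  · intro i k hk
    obtain ⟨hkS, rfl⟩ := Finset.mem_filter.mp hk
    refine (h.lattice_left k hkS).trans (Nat.add_le_add_left ?_ _)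
    split_ifs with h1 h2 <;> simp_all

/-- Two different pairs of columns with the same content witness a multiplicity. -/
theorem IsLRPair.exists_ne (h : IsLRPair lam d e S S' r r') (h' : IsLRPair lam d e T T' t t')
    (hcount : ∀ x, ((if x ∈ S then 1 else 0) + (if x ∈ S' then 1 else 0) : ℕ) =
      (if x ∈ T then 1 else 0) + (if x ∈ T' then 1 else 0))
    (hne : ∃ x ∈ S, ¬ (x ∈ T ∧ t x = r x)) (hed : e ≤ d) {κ : ℕ → ℕ} (hκ : Antitone κ)
    (hmu : ∀ i, mu.rowLen i = κ i + ((if i < d then 1 else 0) + (if i < e then 1 else 0))) :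
    ∃ U U', LRFilling lam mu U ∧ LRFilling lam mu U' ∧
      (∀ x, countAll mu.cells U x = countAll mu.cells U' x) ∧ U ≠ U' := by
  obtain ⟨mu0, hmu0⟩ := exists_youngDiagram_rowLen
    (fun i => (if i < d then 1 else 0) + (if i < e then 1 else 0))
    (fun i i' hi => by dsimp only; split_ifs <;> omega) d
    (by rw [if_neg (lt_irrefl d), if_neg (not_lt.mpr hed)])
  replace hmu : ∀ i, mu.rowLen i = κ i + mu0.rowLen i := fun i => by rw [hmu0, hmu]
  refine ⟨_, _, (h.lrFilling hmu0 hed).extendLeft hκ hmu, (h'.lrFilling hmu0 hed).extendLeft hκ hmu,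
    fun x => ?_, fun hU => ?_⟩
  · rw [countAll_extendLeft hmu, countAll_extendLeft hmu,
      countAll_twoColumns h.isColumn_left h.isColumn_right hmu0 hed,
      countAll_twoColumns h'.isColumn_left h'.isColumn_right hmu0 hed, hcount]
  · obtain ⟨x, hx, hne⟩ := hne
    have hA := congrFun (twoColumns_injective (extendLeft_injective hU)).1 (r x)
    simp only [Finset.ext_iff, Finset.mem_filter] at hA
    exact hne ((hA x).mp ⟨hx, rfl⟩)

end IsLRPair

section Multiplicity

variable {lam mu : YoungDiagram}

theorem YoungDiagram.rowLen_eq_zero_iff {k : ℕ} : lam.rowLen k = 0 ↔ lam.colLen 0 ≤ k := by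
  have : 0 < lam.rowLen k ↔ k < lam.colLen 0 := by
    rw [← mem_cells_iff_lt_rowLen, mem_cells_iff_lt_colLen]
  omega

theorem IsRectangular.of_rowLen_eq
    (h : ∀ k, k + 1 < lam.colLen 0 → lam.rowLen k ≤ lam.rowLen (k + 1)) : IsRectangular lam := by
  have hconst : ∀ k, k < lam.colLen 0 → lam.rowLen k = lam.rowLen 0 := by
    intro k
    induction k with
    | zero => exact fun _ => rfl
    | succ k ih =>
      intro hk
      rw [← ih (by omega)]
      exact (lam.rowLen_anti _ _ k.le_succ).antisymm (h k hk)
  refine ⟨lam.rowLen 0, lam.colLen 0, ?_⟩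
  ext ⟨i, j⟩
  rw [Finset.mem_product, Finset.mem_range, Finset.mem_range,
    YoungDiagram.mem_cells_iff_lt_rowLen]
  have hz := YoungDiagram.rowLen_eq_zero_iff (lam := lam) (k := i)
  constructor
  · intro hij
    have hi : i < lam.colLen 0 := by omega
    exact ⟨hi, hconst i hi ▸ hij⟩
  · rintro ⟨hi, hj⟩
    rwa [hconst i hi]

theorem exists_descent (h : ¬ IsRectangular lam) :
    ∃ q, q + 1 < lam.colLen 0 ∧ lam.rowLen (q + 1) < lam.rowLen q := by
  by_contra! hcon
  exact h (IsRectangular.of_rowLen_eq hcon)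

theorem two_le_rowLen_of_colLen_le_one (h : 2 ≤ lam.card) (hl : lam.colLen 0 ≤ 1) :
    2 ≤ lam.rowLen 0 := by
  by_contra! hlt
  have hsub : lam.cells ⊆ {(0, 0)} := by
    rintro ⟨i, j⟩ hij
    have h1 := YoungDiagram.mem_cells_iff_lt_rowLen.mp hij
    have h2 := lam.rowLen_anti 0 i (Nat.zero_le i)
    have h3 := YoungDiagram.rowLen_eq_zero_iff (lam := lam) (k := i)
    rw [Finset.mem_singleton, Prod.mk.injEq]
    omega
  have := Finset.card_le_card hsub
  rw [Finset.card_singleton] at this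
  exact absurd (h.trans this) (by omega)

theorem exists_ne_of_descent_left {q : ℕ} (hq : q + 1 < lam.colLen 0)
    (hlt : lam.rowLen (q + 1) < lam.rowLen q) (hd : 2 ≤ mu.colLen 0) :
    ∃ U U', LRFilling lam mu U ∧ LRFilling lam mu U' ∧
      (∀ x, countAll mu.cells U x = countAll mu.cells U' x) ∧ U ≠ U' := by
  set p := lam.colLen 0 with hp
  set d := mu.colLen 0 with hd'
  have hz : ∀ k, lam.rowLen k = 0 ↔ p ≤ k := fun k => YoungDiagram.rowLen_eq_zero_iff
  have hz' : ∀ k, mu.rowLen k = 0 ↔ d ≤ k := fun k => YoungDiagram.rowLen_eq_zero_iff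
  have hanti : ∀ k, lam.rowLen (k + 1) ≤ lam.rowLen k := fun k => lam.rowLen_anti _ _ k.le_succ
  have hS : ∀ x, x ∈ insert 0 (insert (q + 1) (Finset.Ico p (p + d - 1))) ↔
      x = 0 ∨ x = q + 1 ∨ p ≤ x ∧ x < p + d - 1 := by simp
  refine IsLRPair.exists_ne (d := d) (e := 0) (S' := ∅) (T' := ∅) (r' := id) (t' := id)
    (S := insert 0 (insert (q + 1) (Finset.Ico p (p + d - 1))))
    (T := insert 0 (insert (q + 1) (Finset.Ico p (p + d - 1))))
    (r := fun x => x + 1 - p) (t := fun x => if x = 0 then 0 else if x ≤ p then 1 else x + 1 - p)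
    (κ := fun i => mu.rowLen i - 1) ?_ ?_ ?_ ?_ ?_ ?_ ?_
  · constructor <;> simp only [hS, Finset.notMem_empty]
    · intros; omega
    · simp
    · intros; omega
    · simp
    · intro i hi
      by_cases h0 : i = 0
      · exact ⟨0, by omega⟩
      · exact ⟨p + i - 1, by omega⟩
    · simp
    · simp
    · simp
    · intro k hk
      have := hz k
      have := hz (k + 1)
      have := hanti k
      by_cases hkq : k = q
      · subst hkq
        split_ifs <;> omega
      · split_ifs <;> omega
  · constructor <;> simp only [hS, Finset.notMem_empty]
    · intros; split_ifs <;> omega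
    · simp
    · intros; split_ifs <;> omega
    · simp
    · intro i hi
      by_cases h0 : i = 0
      · exact ⟨0, by simp [h0]⟩
      · exact ⟨p + i - 1, by omega, by split_ifs <;> omega⟩
    · simp
    · simp
    · simp
    · intro k hk
      have := hz k
      have := hz (k + 1)
      have := hanti k
      by_cases hkq : k = q
      · subst hkq
        split_ifs <;> omega
      · split_ifs <;> omega
  · intro x; rfl
  · refine ⟨q + 1, by simp [hS], ?_⟩
    rintro ⟨-, h⟩
    split_ifs at h <;> omega
  · omega
  · intro i i' hi
    have := mu.rowLen_anti i i' hi
    dsimp only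
    omega
  · intro i
    have := hz' i
    split_ifs <;> omega

theorem exists_ne_of_descent_left_of_row {q : ℕ} (hq : q + 1 < lam.colLen 0)
    (hlt : lam.rowLen (q + 1) < lam.rowLen q) (hd : mu.colLen 0 ≤ 1) (hm : 2 ≤ mu.rowLen 0) :
    ∃ U U', LRFilling lam mu U ∧ LRFilling lam mu U' ∧
      (∀ x, countAll mu.cells U x = countAll mu.cells U' x) ∧ U ≠ U' := by
  have hz : ∀ k, lam.rowLen k = 0 ↔ lam.colLen 0 ≤ k := fun k => YoungDiagram.rowLen_eq_zero_iff
  have hz' : ∀ k, mu.rowLen k = 0 ↔ mu.colLen 0 ≤ k := fun k => YoungDiagram.rowLen_eq_zero_iff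
  generalize lam.colLen 0 = p at *
  refine IsLRPair.exists_ne (d := 1) (e := 1) (S := {0, q + 1}) (S' := {p}) (T := {0})
    (T' := {q + 1, p}) (r := fun _ => 0) (t := fun _ => 0) (r' := fun _ => 0) (t' := fun _ => 0)
    (κ := fun i => mu.rowLen i - 2) ?_ ?_ ?_ ?_ le_rfl ?_ ?_
  · constructor <;> simp only [Finset.mem_insert, Finset.mem_singleton]
    · simp
    · simp
    · simp
    · simp
    · exact fun i hi => ⟨0, Or.inl rfl, by omega⟩
    · exact fun i hi => ⟨p, rfl, by omega⟩
    · intros; omega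
    · rintro k rfl
      have := hz k
      have := hz (k + 1)
      split_ifs <;> omega
    · intro k hk
      obtain rfl : k = q := by omega
      split_ifs <;> omega
  · constructor <;> simp only [Finset.mem_insert, Finset.mem_singleton]
    · simp
    · simp
    · simp
    · simp
    · exact fun i hi => ⟨0, rfl, by omega⟩
    · exact fun i hi => ⟨p, Or.inr rfl, by omega⟩
    · intros; omega
    · rintro k (hk | rfl)
      · obtain rfl : k = q := by omega
        split_ifs <;> omega
      · have := hz k
        have := hz (k + 1)
        split_ifs <;> omega
    · intros; omega
  · intro x
    simp only [Finset.mem_insert, Finset.mem_singleton]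
    split_ifs <;> omega
  · refine ⟨q + 1, by simp, ?_⟩
    simp
  · intro i i' hi
    have := mu.rowLen_anti i i' hi
    dsimp only
    omega
  · intro i
    have := hz' i
    split_ifs with hi
    · obtain rfl : i = 0 := by omega
      omega
    · omega

theorem rowLen_eq_of_descent {e : ℕ} (he : e + 1 < mu.colLen 0)
    (hlt : mu.rowLen (e + 1) < mu.rowLen e) :
    Antitone (fun i => mu.rowLen i - ((if i < mu.colLen 0 then 1 else 0) +
      (if i < e + 1 then 1 else 0))) ∧
    ∀ i, mu.rowLen i = (mu.rowLen i - ((if i < mu.colLen 0 then 1 else 0) +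
      (if i < e + 1 then 1 else 0))) +
        ((if i < mu.colLen 0 then 1 else 0) + (if i < e + 1 then 1 else 0)) := by
  have hz : ∀ k, mu.rowLen k = 0 ↔ mu.colLen 0 ≤ k := fun k => YoungDiagram.rowLen_eq_zero_iff
  have hpos := hz (e + 1)
  constructor
  · intro i i' hi
    have h1 := mu.rowLen_anti i i' hi
    dsimp only
    by_cases hi' : i < e + 1 ∧ e + 1 ≤ i'
    · have h2 := mu.rowLen_anti i e (by omega)
      have h3 := mu.rowLen_anti (e + 1) i' hi'.2
      have := hz i'
      split_ifs <;> omega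
    · have := hz i'
      split_ifs <;> omega
  · intro i
    have := hz i
    by_cases hi : i < e + 1
    · have h2 := mu.rowLen_anti i e (by omega)
      split_ifs <;> omega
    · split_ifs <;> omega

theorem exists_ne_of_descent_right {e : ℕ} (he : e + 1 < mu.colLen 0)
    (hlt : mu.rowLen (e + 1) < mu.rowLen e) (hh : 2 ≤ lam.colLen 0) :
    ∃ U U', LRFilling lam mu U ∧ LRFilling lam mu U' ∧
      (∀ x, countAll mu.cells U x = countAll mu.cells U' x) ∧ U ≠ U' := by
  obtain ⟨hκ, hmu⟩ := rowLen_eq_of_descent he hlt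
  have hz : ∀ k, lam.rowLen k = 0 ↔ lam.colLen 0 ≤ k := fun k => YoungDiagram.rowLen_eq_zero_iff
  have hanti : ∀ k, lam.rowLen (k + 1) ≤ lam.rowLen k := fun k => lam.rowLen_anti _ _ k.le_succ
  generalize lam.colLen 0 = h at *
  generalize mu.colLen 0 = d at *
  refine IsLRPair.exists_ne (d := d) (e := e + 1)
    (S := Finset.range (e + 2) ∪ Finset.Ico (h + e) (h + d - 1))
    (S' := insert 0 (Finset.Ico h (h + e)))
    (r := fun x => if x ≤ e + 1 then x else x + 1 - h) (r' := fun x => x + 1 - h)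
    (T := Finset.range (e + 2) ∪ Finset.Ico (h + e + 1) (h + d - 1))
    (T' := insert 0 (Finset.Ico h (h + e + 1)))
    (t := fun x => if x ≤ e + 1 then x else x + 1 - h) (t' := fun x => x - h)
    ?_ ?_ ?_ ?_ (by omega) hκ hmu
  · constructor <;> simp only [Finset.mem_insert, Finset.mem_union, Finset.mem_range,
      Finset.mem_Ico, Nat.add_one_ne_zero, false_or]
    · intros; split_ifs <;> omega
    · intros; omega
    · intros; split_ifs <;> omega
    · intros; omega
    · intro i hi
      by_cases h0 : i ≤ e + 1
      · exact ⟨i, by omega, by rw [if_pos h0]⟩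
      · exact ⟨h + i - 1, by omega, by split_ifs <;> omega⟩
    · intro i hi
      by_cases h0 : i = 0
      · exact ⟨0, by omega, by omega⟩
      · exact ⟨h + i - 1, by omega, by omega⟩
    · intro x hx y hy; split_ifs <;> omega
    · intro k hk
      have := hz k
      have := hz (k + 1)
      have := hanti k
      split_ifs <;> omega
    · intro k hk
      have := hz k
      have := hz (k + 1)
      have := hanti k
      by_cases h1 : k + 1 ≤ e + 1
      · simp only [if_pos h1, if_pos (Nat.le_of_succ_le h1)]
        split_ifs <;> omega
      · by_cases h2 : k ≤ e + 1
        · simp only [if_neg h1, if_pos h2]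
          split_ifs <;> omega
        · simp only [if_neg h1, if_neg h2]
          split_ifs <;> omega
  · constructor <;> simp only [Finset.mem_insert, Finset.mem_union, Finset.mem_range,
      Finset.mem_Ico, Nat.add_one_ne_zero, false_or]
    · intros; split_ifs <;> omega
    · intros; omega
    · intros; split_ifs <;> omega
    · intros; omega
    · intro i hi
      by_cases h0 : i ≤ e + 1
      · exact ⟨i, by omega, by rw [if_pos h0]⟩
      · exact ⟨h + i - 1, by omega, by split_ifs <;> omega⟩
    · intro i hi
      exact ⟨h + i, by omega, by omega⟩
    · intro x hx y hy; split_ifs <;> omega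
    · intro k hk
      have := hz k
      have := hz (k + 1)
      have := hanti k
      split_ifs <;> omega
    · intro k hk
      have := hz k
      have := hz (k + 1)
      have := hanti k
      by_cases h1 : k + 1 ≤ e + 1
      · simp only [if_pos h1, if_pos (Nat.le_of_succ_le h1)]
        split_ifs <;> omega
      · by_cases h2 : k ≤ e + 1
        · simp only [if_neg h1, if_pos h2]
          split_ifs <;> omega
        · simp only [if_neg h1, if_neg h2]
          split_ifs <;> omega
  · intro x
    simp only [Finset.mem_insert, Finset.mem_union, Finset.mem_range, Finset.mem_Ico]
    split_ifs <;> omega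
  · simp only [Finset.mem_union, Finset.mem_range, Finset.mem_Ico]
    exact ⟨h + e, by omega, by omega⟩

theorem exists_ne_of_descent_right_of_row {e : ℕ} (he : e + 1 < mu.colLen 0)
    (hlt : mu.rowLen (e + 1) < mu.rowLen e) (hh : lam.colLen 0 ≤ 1) (hm : 2 ≤ lam.rowLen 0) :
    ∃ U U', LRFilling lam mu U ∧ LRFilling lam mu U' ∧
      (∀ x, countAll mu.cells U x = countAll mu.cells U' x) ∧ U ≠ U' := by
  obtain ⟨hκ, hmu⟩ := rowLen_eq_of_descent he hlt
  have hz : ∀ k, lam.rowLen (k + 1) = 0 := fun k =>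
    YoungDiagram.rowLen_eq_zero_iff.mpr (by omega)
  generalize mu.colLen 0 = d at *
  refine IsLRPair.exists_ne (d := d) (e := e + 1)
    (S := Finset.range (d + 1)) (S' := Finset.Ico 1 (e + 2))
    (r := fun x => if x ≤ e + 1 then x else x - 1) (r' := fun x => x - 1)
    (T := Finset.range (d + 1)) (T' := Finset.Ico 1 (e + 2))
    (t := fun x => x - 1) (t' := fun x => x - 1)
    ?_ ?_ (fun x => rfl) ?_ (by omega) hκ hmu
  · constructor <;> simp only [Finset.mem_range, Finset.mem_Ico]
    · intros; split_ifs <;> omega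
    · intros; omega
    · intros; split_ifs <;> omega
    · intros; omega
    · intro i hi
      by_cases h0 : i ≤ e + 1
      · exact ⟨i, by omega, by rw [if_pos h0]⟩
      · exact ⟨i + 1, by omega, by split_ifs <;> omega⟩
    · exact fun i hi => ⟨i + 1, by omega, by omega⟩
    · intro x hx y hy; split_ifs <;> omega
    · rintro (_ | k) hk
      · have := hz 0
        split_ifs <;> omega
      · rw [hz, hz]
        split_ifs <;> omega
    · rintro (_ | k) hk
      · have := hz 0
        split_ifs <;> omega
      · rw [hz, hz]
        split_ifs <;> omega
  · constructor <;> simp only [Finset.mem_range, Finset.mem_Ico]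
    · intros; omega
    · intros; omega
    · intros; omega
    · intros; omega
    · exact fun i hi => ⟨i + 1, by omega, by omega⟩
    · exact fun i hi => ⟨i + 1, by omega, by omega⟩
    · intros; omega
    · rintro (_ | k) hk
      · have := hz 0
        split_ifs <;> omega
      · rw [hz, hz]
        split_ifs <;> omega
    · rintro (_ | k) hk
      · have := hz 0
        split_ifs <;> omega
      · rw [hz, hz]
        split_ifs <;> omega
  · exact ⟨1, by simp; omega, by simp⟩

end Multiplicity

/-- **Classification of multiplicity-free products** (Proposition 7.2): the
product `G_λ · G_μ` is multiplicity free, i.e. `c^ν_{λμ} ∈ {-1, 0, 1}` for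
every partition `ν`, if and only if `λ` and `μ` are both rectangular, or one
of them is empty or a single box. -/
theorem multiplicity_free_iff (lam mu : YoungDiagram) :
    (∀ nu : YoungDiagram, cLR lam mu nu = -1 ∨ cLR lam mu nu = 0 ∨ cLR lam mu nu = 1) ↔
      ((IsRectangular lam ∧ IsRectangular mu) ∨ lam.card ≤ 1 ∨ mu.card ≤ 1) := by
  rw [multiplicityFree_iff_lrFilling]
  refine ⟨fun h => ?_, fun H U U' h h' hc => LRFilling.unique H h h' hc⟩
  by_contra! hcon
  obtain ⟨hrect, hl, hm⟩ := hcon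
  obtain ⟨U, U', hU, hU', hc, hne⟩ : ∃ U U', LRFilling lam mu U ∧ LRFilling lam mu U' ∧
      (∀ x, countAll mu.cells U x = countAll mu.cells U' x) ∧ U ≠ U' := by
    by_cases hlam : IsRectangular lam
    · obtain ⟨e, he, hlt⟩ := exists_descent (hrect hlam)
      rcases Nat.lt_or_ge 1 (lam.colLen 0) with hd | hd
      · exact exists_ne_of_descent_right he hlt hd
      · exact exists_ne_of_descent_right_of_row he hlt hd
          (two_le_rowLen_of_colLen_le_one hl hd)
    · obtain ⟨q, hq, hlt⟩ := exists_descent hlam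
      rcases Nat.lt_or_ge 1 (mu.colLen 0) with hd | hd
      · exact exists_ne_of_descent_left hq hlt hd
      · exact exists_ne_of_descent_left_of_row hq hlt hd (two_le_rowLen_of_colLen_le_one hm hd)
  exact hne (h U U' hU hU' hc)
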